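/- Let G and H be rayless graphs, let X ⊆ V(G) and Y ⊆ V(H) be finite vertex sets, and suppose the pairs (G,X) and (H,Y) are weak twins. Then there exist infinitely many pairwise non-isomorphic pairs (H',Y') (H' a graph, Y' ⊆ V(H') finite) each of which is a weak twin of (G,X). -/

import Mathlib

/-- A graph is rayless if it contains no ray, i.e. no infinite sequence of distinct
vertices `v₀, v₁, v₂, …` with `vᵢ` adjacent to `vᵢ₊₁` for all `i`. -/
def SimpleGraph.IsRayless {V : Type*} (G : SimpleGraph V) : Prop :=
  ¬ ∃ f : ℕ → V, Function.Injective f ∧ ∀ n, G.Adj (f n) (f (n + 1))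

/-- Two pairs `(G, X)` and `(H, Y)` are isomorphic if there is a graph isomorphism
`γ : G ≃g H` with `γ(X) = Y`. -/
def PairIso {V W : Type*} (G : SimpleGraph V) (X : Set V)
    (H : SimpleGraph W) (Y : Set W) : Prop :=
  ∃ γ : G ≃g H, ⇑γ '' X = Y

/-- Two pairs `(G, X)` and `(H, Y)` are weak twins if they are not isomorphic as
pairs, yet there are injective graph homomorphisms `φ : G →g H` with `φ(X) = Y` and
`ψ : H →g G` with `ψ(Y) = X`. -/
def WeakTwinPairs {V W : Type*} (G : SimpleGraph V) (X : Set V)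
    (H : SimpleGraph W) (Y : Set W) : Prop :=
  ¬ PairIso G X H Y ∧ (∃ φ : G →g H, Function.Injective φ ∧ ⇑φ '' X = Y) ∧
    (∃ ψ : H →g G, Function.Injective ψ ∧ ⇑ψ '' Y = X)

universe u

namespace RT

/-- A graph whose vertices are coloured by a partially ordered set. -/
structure CG (P : Type u) where
  V : Type u
  G : SimpleGraph V
  c : V → P

set_option linter.unusedSectionVars false
set_option linter.unusedVariables false

section Basic

variable {P : Type u} [PartialOrder P]

def IsEmb (A B : CG P) (f : A.V → B.V) : Prop :=
  Function.Injective f ∧ (∀ a b, A.G.Adj a b → B.G.Adj (f a) (f b)) ∧ ∀ a, A.c a ≤ B.c (f a)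

def Le (A B : CG P) : Prop := ∃ f, IsEmb A B f

def Eqv (A B : CG P) : Prop := Le A B ∧ Le B A

def Iso (A B : CG P) : Prop :=
  ∃ e : A.V ≃ B.V, (∀ a b, A.G.Adj a b ↔ B.G.Adj (e a) (e b)) ∧ ∀ a, A.c a = B.c (e a)

def Conn (A : CG P) : Prop := A.G.Connected

theorem IsEmb.comp {A B C : CG P} {f : A.V → B.V} {g : B.V → C.V} (hg : IsEmb B C g)
    (hf : IsEmb A B f) : IsEmb A C (fun x => g (f x)) :=
  ⟨hg.1.comp hf.1, fun a b h => hg.2.1 _ _ (hf.2.1 _ _ h), fun a => (hf.2.2 a).trans (hg.2.2 _)⟩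

theorem IsEmb.refl (A : CG P) : IsEmb A A (fun x => x) :=
  ⟨fun _ _ h => h, fun _ _ h => h, fun _ => le_rfl⟩

theorem Le.refl (A : CG P) : Le A A := ⟨_, IsEmb.refl A⟩

theorem Le.trans {A B C : CG P} (h : Le A B) (h' : Le B C) : Le A C := by
  obtain ⟨f, hf⟩ := h
  obtain ⟨g, hg⟩ := h'
  exact ⟨_, hg.comp hf⟩

theorem Eqv.refl (A : CG P) : Eqv A A := ⟨Le.refl A, Le.refl A⟩
theorem Eqv.symm {A B : CG P} (h : Eqv A B) : Eqv B A := ⟨h.2, h.1⟩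
theorem Eqv.trans {A B C : CG P} (h : Eqv A B) (h' : Eqv B C) : Eqv A C :=
  ⟨h.1.trans h'.1, h'.2.trans h.2⟩

theorem Iso.refl (A : CG P) : Iso A A := ⟨Equiv.refl _, fun _ _ => Iff.rfl, fun _ => rfl⟩
theorem Iso.symm {A B : CG P} (h : Iso A B) : Iso B A := by
  obtain ⟨e, h1, h2⟩ := h
  exact ⟨e.symm, fun a b => by simp [h1], fun a => by simp [h2]⟩
theorem Iso.trans {A B C : CG P} (h : Iso A B) (h' : Iso B C) : Iso A C := by
  obtain ⟨e, h1, h2⟩ := h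
  obtain ⟨e', h1', h2'⟩ := h'
  exact ⟨e.trans e', fun a b => by simp [h1, h1'], fun a => by simp [h2, h2']⟩

theorem Iso.le {A B : CG P} (h : Iso A B) : Le A B := by
  obtain ⟨e, h1, h2⟩ := h
  exact ⟨e, e.injective, fun a b => (h1 a b).1, fun a => (h2 a).le⟩

theorem Iso.eqv {A B : CG P} (h : Iso A B) : Eqv A B := ⟨h.le, h.symm.le⟩

/-- disjoint union of a family -/
def sig {I : Type u} (C : I → CG P) : CG P where
  V := Σ i, (C i).V
  G :=
    { Adj := fun x y => ∃ i a b, x = ⟨i, a⟩ ∧ y = ⟨i, b⟩ ∧ (C i).G.Adj a b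
      symm := by
        constructor
        rintro _ _ ⟨i, a, b, rfl, rfl, h⟩
        exact ⟨i, b, a, rfl, rfl, h.symm⟩
      loopless := by
        constructor
        rintro _ ⟨i, a, b, rfl, h, h'⟩
        obtain rfl : a = b := by simpa using h
        exact h'.ne rfl }
  c := fun x => (C x.1).c x.2

variable {I J : Type u} {C : I → CG P} {D : J → CG P}

def sin (i : I) (a : (C i).V) : (sig C).V := ⟨i, a⟩
def sidx (x : (sig C).V) : I := x.1

@[simp] theorem sidx_sin (i : I) (a : (C i).V) : sidx (sin i a : (sig C).V) = i := rfl

theorem sin_inj {i : I} {a b : (C i).V} (h : (sin i a : (sig C).V) = sin i b) : a = b :=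
  eq_of_heq (Sigma.mk.inj h).2

theorem sin_inj_idx {i j : I} {a : (C i).V} {b : (C j).V} (h : (sin i a : (sig C).V) = sin j b) :
    i = j := congrArg sidx h

theorem exists_sin (x : (sig C).V) : ∃ i a, x = sin i a := ⟨x.1, x.2, rfl⟩

theorem exists_sin_of {x : (sig C).V} {i : I} (h : sidx x = i) : ∃ a, x = sin i a := by
  obtain ⟨j, a, rfl⟩ := exists_sin x
  obtain rfl : j = i := h
  exact ⟨a, rfl⟩

theorem sig_c (i : I) (a : (C i).V) : (sig C).c (sin i a) = (C i).c a := rfl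

theorem sig_adj {i : I} {a b : (C i).V} :
    (sig C).G.Adj (sin i a) (sin i b) ↔ (C i).G.Adj a b := by
  constructor
  · rintro ⟨j, a', b', h, h', h''⟩
    cases h
    cases h'
    exact h''
  · intro h
    exact ⟨i, a, b, rfl, rfl, h⟩

theorem sig_adj_fst {x y : (sig C).V} (h : (sig C).G.Adj x y) : sidx x = sidx y := by
  obtain ⟨i, a, b, rfl, rfl, h⟩ := h
  rfl

theorem sig_adj_elim {x y : (sig C).V} (h : (sig C).G.Adj x y) :
    ∃ i a b, x = sin i a ∧ y = sin i b ∧ (C i).G.Adj a b := h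

theorem isEmb_incl (i : I) : IsEmb (C i) (sig C) (sin i) :=
  ⟨fun a b h => sin_inj h, fun a b h => sig_adj.2 h, fun _ => le_rfl⟩

def sdesc {X : Type*} (h : ∀ i, (C i).V → X) (x : (sig C).V) : X := h x.1 x.2
@[simp] theorem sdesc_sin {X : Type*} (h : ∀ i, (C i).V → X) (i : I) (a : (C i).V) :
    sdesc h (sin i a : (sig C).V) = h i a := rfl

theorem isEmb_desc {X : CG P} (h : ∀ i, (C i).V → X.V) (hh : ∀ i, IsEmb (C i) X (h i))
    (hd : ∀ i j a b, h i a = h j b → i = j) : IsEmb (sig C) X (sdesc h) := by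
  refine ⟨?_, ?_, ?_⟩
  · intro x y hab
    obtain ⟨i, a, rfl⟩ := exists_sin x
    obtain ⟨j, b, rfl⟩ := exists_sin y
    obtain rfl := hd _ _ _ _ hab
    obtain rfl := (hh i).1 hab
    rfl
  · intro x y hab
    obtain ⟨i, a, b, rfl, rfl, h⟩ := sig_adj_elim hab
    exact (hh i).2.1 _ _ h
  · intro x
    obtain ⟨i, a, rfl⟩ := exists_sin x
    exact (hh i).2.2 a

theorem sig_le_of (f : I → J) (hf : Function.Injective f) (h : ∀ i, Le (C i) (D (f i))) :
    Le (sig C) (sig D) := by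
  choose g hg using h
  refine ⟨_, isEmb_desc (fun i a => sin (f i) (g i a))
    (fun i => (isEmb_incl (f i)).comp (hg i)) ?_⟩
  intro i j a b hab
  exact hf (sin_inj_idx hab)

/-- binary disjoint union -/
def plus (A B : CG P) : CG P where
  V := A.V ⊕ B.V
  G := A.G ⊕g B.G
  c := Sum.elim A.c B.c

def pl {A B : CG P} (a : A.V) : (plus A B).V := Sum.inl a
def pr {A B : CG P} (a : B.V) : (plus A B).V := Sum.inr a

theorem pl_ne_pr {A B : CG P} (a : A.V) (b : B.V) : (pl a : (plus A B).V) ≠ pr b :=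
  fun h => Sum.inl_ne_inr h

theorem isEmb_pl (A B : CG P) : IsEmb A (plus A B) pl :=
  ⟨Sum.inl_injective, fun a b h => by simpa [plus, pl] using h, fun _ => le_rfl⟩
theorem isEmb_pr (A B : CG P) : IsEmb B (plus A B) pr :=
  ⟨Sum.inr_injective, fun a b h => by simpa [plus, pr] using h, fun _ => le_rfl⟩

theorem exists_emb_plus {A B X : CG P} {f : A.V → X.V} {g : B.V → X.V} (hf : IsEmb A X f)
    (hg : IsEmb B X g) (hd : ∀ a b, f a ≠ g b) :
    ∃ h, IsEmb (plus A B) X h ∧ (∀ a, h (pl a) = f a) ∧ (∀ b, h (pr b) = g b) := by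
  refine ⟨Sum.elim f g, ⟨hf.1.sumElim hg.1 hd, ?_, ?_⟩, fun _ => rfl, fun _ => rfl⟩
  · rintro (a | a) (b | b) h
    · exact hf.2.1 a b (by simpa [plus] using h)
    · simp [plus] at h
    · simp [plus] at h
    · exact hg.2.1 a b (by simpa [plus] using h)
  · rintro (a | a)
    · exact hf.2.2 a
    · exact hg.2.2 a

theorem plus_le {A B X : CG P} {f : A.V → X.V} {g : B.V → X.V} (hf : IsEmb A X f)
    (hg : IsEmb B X g) (hd : ∀ a b, f a ≠ g b) : Le (plus A B) X := by
  obtain ⟨h, hh, -⟩ := exists_emb_plus hf hg hd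
  exact ⟨h, hh⟩

theorem plus_mono {A B A' B' : CG P} (h : Le A A') (h' : Le B B') :
    Le (plus A B) (plus A' B') := by
  obtain ⟨f, hf⟩ := h
  obtain ⟨g, hg⟩ := h'
  exact plus_le ((isEmb_pl A' B').comp hf) ((isEmb_pr A' B').comp hg) (fun a b => pl_ne_pr _ _)

theorem le_plus_right (A B : CG P) : Le B (plus A B) := ⟨_, isEmb_pr A B⟩

theorem exists_index {S : CG P} (hS : Conn S) {h : S.V → (sig D).V}
    (hh : ∀ a b, S.G.Adj a b → (sig D).G.Adj (h a) (h b)) : ∃ j, ∀ a, sidx (h a) = j := by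
  obtain ⟨a0⟩ := hS.nonempty
  refine ⟨sidx (h a0), fun a => ?_⟩
  obtain ⟨w⟩ := hS.preconnected a a0
  induction w with
  | nil => rfl
  | cons hadj _ ih => exact (sig_adj_fst (hh _ _ hadj)).trans ih

theorem exists_factor {S : CG P} {h : S.V → (sig D).V} (hh : IsEmb S (sig D) h) {j : J}
    (hj : ∀ a, sidx (h a) = j) :
    ∃ h' : S.V → (D j).V, IsEmb S (D j) h' ∧ ∀ a, h a = sin j (h' a) := by
  have : ∀ a, ∃ b : (D j).V, h a = sin j b := fun a => exists_sin_of (hj a)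
  choose h' hh' using this
  refine ⟨h', ⟨?_, ?_, ?_⟩, hh'⟩
  · intro a b hab
    apply hh.1
    rw [hh', hh', hab]
  · intro a b hab
    have := hh.2.1 a b hab
    rw [hh', hh', sig_adj] at this
    exact this
  · intro a
    have := hh.2.2 a
    rw [hh'] at this
    exact this

theorem exists_compMap (hC : ∀ i, Conn (C i)) {h : (sig C).V → (sig D).V}
    (hh : ∀ a b, (sig C).G.Adj a b → (sig D).G.Adj (h a) (h b)) :
    ∃ f : I → J, ∀ x, sidx (h x) = f (sidx x) := by
  have : ∀ i, ∃ j, ∀ a, sidx (h (sin i a)) = j := fun i =>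
    exists_index (D := D) (hC i) (h := fun a => h (sin i a)) (fun a b hab => hh _ _ (sig_adj.2 hab))
  choose f hf using this
  refine ⟨f, fun x => ?_⟩
  obtain ⟨i, a, rfl⟩ := exists_sin x
  exact hf i a

theorem le_of_compMap {h : (sig C).V → (sig D).V} (hh : IsEmb (sig C) (sig D) h) {f : I → J}
    (hf : ∀ x, sidx (h x) = f (sidx x)) (i : I) : Le (C i) (D (f i)) := by
  obtain ⟨h', h1, h2⟩ := exists_factor (hh.comp (isEmb_incl i)) (j := f i) (fun a => hf (sin i a))
  exact ⟨h', h1⟩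

theorem iso_sig_elim (hC : ∀ i, Conn (C i)) (hD : ∀ i, Conn (D i)) (h : Iso (sig C) (sig D)) :
    ∃ e : I ≃ J, ∀ i, Iso (C i) (D (e i)) := by
  obtain ⟨e, h1, h2⟩ := h
  obtain ⟨f, hf⟩ := exists_compMap (D := D) hC (h := e) (fun a b => (h1 a b).1)
  obtain ⟨g, hg⟩ := exists_compMap (D := C) hD (h := e.symm) (fun a b => by
    intro hab; rw [h1]; simpa using hab)
  have hgf : ∀ i, g (f i) = i := by
    intro i
    obtain ⟨a⟩ := (hC i).nonempty
    have := hg (e (sin i a))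
    rw [hf, e.symm_apply_apply] at this
    exact this.symm
  have hfg : ∀ i, f (g i) = i := by
    intro i
    obtain ⟨a⟩ := (hD i).nonempty
    have := hf (e.symm (sin i a))
    rw [hg, e.apply_symm_apply] at this
    exact this.symm
  refine ⟨⟨f, g, hgf, hfg⟩, fun i => ?_⟩
  have hemb : IsEmb (sig C) (sig D) e := ⟨e.injective, fun a b => (h1 a b).1, fun a => (h2 a).le⟩
  obtain ⟨h', hh1, hh2⟩ := exists_factor (hemb.comp (isEmb_incl i)) (j := f i)
    (fun a => hf (sin i a))
  have hsurj : Function.Surjective h' := by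
    intro b
    have h3 : sidx (e.symm (sin (f i) b)) = i := by rw [hg]; exact hgf i
    obtain ⟨a, ha⟩ := exists_sin_of h3
    refine ⟨a, ?_⟩
    have h4 := hh2 a
    rw [← ha, e.apply_symm_apply] at h4
    exact (sin_inj h4).symm
  refine ⟨Equiv.ofBijective h' ⟨hh1.1, hsurj⟩, fun a b => ?_, fun a => ?_⟩
  · have := h1 (sin i a) (sin i b)
    rw [hh2, hh2, sig_adj, sig_adj] at this
    exact this
  · have := h2 (sin i a)
    rw [hh2] at this
    exact this

theorem iso_sig_intro (e : I ≃ J) (h : ∀ i, Iso (C i) (D (e i))) : Iso (sig C) (sig D) := by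
  choose g h1 h2 using h
  refine ⟨Equiv.sigmaCongr e g, ?_, fun x => h2 x.1 x.2⟩
  intro x y
  obtain ⟨i, a, rfl⟩ := exists_sin x
  obtain ⟨j, b, rfl⟩ := exists_sin y
  change _ ↔ (sig D).G.Adj (sin (e i) (g i a)) (sin (e j) (g j b))
  constructor
  · intro hab
    obtain rfl : i = j := sig_adj_fst hab
    exact sig_adj.2 ((h1 i a b).1 (sig_adj.1 hab))
  · intro hab
    obtain rfl : i = j := e.injective (sig_adj_fst hab)
    exact sig_adj.2 ((h1 i a b).2 (sig_adj.1 hab))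

end Basic

section Union

open Cardinal

variable {P : Type u} [PartialOrder P] {I J : Type u} {C : I → CG P} {D : J → CG P}

theorem plus_sig_le {K : Type u} {E : K → CG P} (f : I → K) (g : J → K)
    (hf : Function.Injective f) (hg : Function.Injective g) (hfg : ∀ i j, f i ≠ g j)
    (h1 : ∀ i, Le (C i) (E (f i))) (h2 : ∀ j, Le (D j) (E (g j))) :
    Le (plus (sig C) (sig D)) (sig E) := by
  choose u hu using h1
  choose v hv using h2
  refine plus_le (isEmb_desc (fun i a => sin (f i) (u i a))
    (fun i => (isEmb_incl (f i)).comp (hu i)) ?_) (isEmb_desc (fun i a => sin (g i) (v i a))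
    (fun i => (isEmb_incl (g i)).comp (hv i)) ?_) ?_
  · intro i j a b hab
    exact hf (sin_inj_idx hab)
  · intro i j a b hab
    exact hg (sin_inj_idx hab)
  · intro x y hxy
    obtain ⟨i, a, rfl⟩ := exists_sin x
    obtain ⟨j, b, rfl⟩ := exists_sin y
    exact hfg i j (sin_inj_idx hxy)

/-- multiplicity of `S` as a component -/
def mult (C : I → CG P) (S : CG P) : Cardinal.{u} := #{i // Iso (C i) S}

theorem le_sig_sub {A : CG P} {u : A.V → (sig C).V} (hu : IsEmb A (sig C) u) (q : I → Prop)
    (hq : ∀ x, q (sidx (u x))) : Le A (sig (fun i : {i // q i} => C i)) := by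
  have : ∀ x, ∃ y : (sig (fun i : {i // q i} => C i)).V, ∃ (i : {i // q i}) (a : (C i).V),
      y = sin i a ∧ u x = sin (i : I) a := by
    intro x
    obtain ⟨i, a, h⟩ := exists_sin (u x)
    have hqi := hq x
    rw [h] at hqi
    exact ⟨sin ⟨i, hqi⟩ a, ⟨i, hqi⟩, a, rfl, h⟩
  choose v i a hv hua using this
  refine ⟨v, ?_, ?_, ?_⟩
  · intro x y hxy
    apply hu.1
    rw [hua, hua]
    have h1 := hv x
    rw [hxy, hv y] at h1
    generalize a x = a' at *
    generalize a y = b' at *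
    generalize i x = i' at *
    generalize i y = j' at *
    obtain rfl := sin_inj_idx h1
    rw [sin_inj h1]
  · intro x y hxy
    have h1 := hu.2.1 x y hxy
    rw [hua, hua] at h1
    rw [hv, hv]
    have h2 := sig_adj_fst h1
    simp only [sidx_sin] at h2
    have h3 : i x = i y := Subtype.ext h2
    generalize a x = a' at *
    generalize a y = b' at *
    generalize i x = i' at *
    generalize i y = j' at *
    subst h3
    exact sig_adj.2 (sig_adj.1 h1)
  · intro x
    have h1 := hu.2.2 x
    rw [hua] at h1
    rw [hv]
    exact h1

theorem step_two (hC : ∀ i, Conn (C i)) (h : Eqv (sig C) (sig D)) {S : CG P} (hS : Conn S)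
    (hSS : ¬ Le (plus S S) S) (hlt : mult C S < mult D S) (hinf : ℵ₀ ≤ mult D S) :
    Le (plus S (sig C)) (sig (fun i : {i // ¬ Iso (C i) S} => C i)) := by
  classical
  let κ := {j // Iso (D j) S}
  let M := {i // Iso (C i) S}
  have hκ : ℵ₀ ≤ #κ := hinf
  have : Infinite κ := Cardinal.infinite_iff.2 hκ
  have hA : Le (plus (sig (fun _ : κ => S)) (sig D)) (sig D) := by
    have : Nonempty (κ ⊕ κ ≃ κ) := by
      rw [← Cardinal.eq]
      simp [Cardinal.add_eq_left hκ le_rfl]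
    obtain ⟨e⟩ := this
    refine plus_sig_le (fun k => (e (Sum.inl k)).1)
      (fun j => if hj : Iso (D j) S then (e (Sum.inr ⟨j, hj⟩)).1 else j) ?_ ?_ ?_ ?_ ?_
    · intro a b hab
      simpa using e.injective (Subtype.ext hab)
    · intro a b hab
      by_cases ha : Iso (D a) S <;> by_cases hb : Iso (D b) S
      · simp only [ha, hb, dif_pos] at hab
        exact congrArg Subtype.val (Sum.inr_injective (e.injective (Subtype.ext hab)))
      · simp only [ha, hb, dif_pos, dif_neg, not_false_eq_true] at hab
        exact absurd (hab ▸ (e (Sum.inr ⟨a, ha⟩)).2) hb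
      · simp only [ha, hb, dif_pos, dif_neg, not_false_eq_true] at hab
        exact absurd (hab ▸ (e (Sum.inr ⟨b, hb⟩)).2) ha
      · simpa only [ha, hb, dif_neg, not_false_eq_true] using hab
    · intro a b hab
      by_cases hb : Iso (D b) S
      · simp only [hb, dif_pos] at hab
        simpa using e.injective (Subtype.ext hab)
      · simp only [hb] at hab
        exact hb (by simpa [hab] using (e (Sum.inl a)).2)
    · intro k
      exact (e (Sum.inl k)).2.symm.le
    · intro j
      by_cases hj : Iso (D j) S
      · simp only [hj, dif_pos]
        exact (hj.trans (e (Sum.inr ⟨j, hj⟩)).2.symm).le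
      · simp only [hj, dif_neg, not_false_eq_true]
        exact Le.refl _
  have hB : Le (plus (sig (fun _ : κ => S)) (sig C)) (sig C) :=
    (plus_mono (Le.refl _) h.1).trans (hA.trans h.2)
  let W := plus (sig (fun _ : κ => S)) (sig C)
  obtain ⟨g, hg⟩ := hB
  have hgk : ∀ k : κ, IsEmb S (sig C) (fun a => g (pl (sin k a))) := fun k =>
    hg.comp ((isEmb_pl _ _).comp (isEmb_incl (C := fun _ : κ => S) k))
  have hidx : ∀ k : κ, ∃ i, ∀ a, sidx (g (pl (sin k a))) = i := fun k =>
    exists_index hS (hgk k).2.1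
  choose fk hfk using hidx
  let B : Set κ := {k | Iso (C (fk k)) S}
  have hBle : #B ≤ #M := by
    refine Cardinal.mk_le_of_injective (f := fun k : B => (⟨fk k.1, k.2⟩ : M)) ?_
    rintro ⟨k, hk⟩ ⟨l, hl⟩ hkl
    have hkl' : fk k = fk l := congrArg Subtype.val hkl
    by_contra hne
    have hne' : k ≠ l := fun h => hne (Subtype.ext h)
    obtain ⟨u, hu, hu'⟩ := exists_factor (hgk k) (hfk k)
    obtain ⟨v, hv, hv'⟩ := exists_factor (hgk l) (j := fk k) (by rw [hkl']; exact hfk l)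
    refine hSS ((plus_le hu hv ?_).trans (Iso.le hk))
    intro a b hab
    have h1 := hu' a
    rw [hab, ← hv' b] at h1
    have h2 := (isEmb_pl _ _).1 (hg.1 h1)
    exact hne' (sin_inj_idx h2)
  have hBlt : #B < #κ := lt_of_le_of_lt hBle hlt
  have hBc : #(Bᶜ : Set κ) = #κ := Cardinal.mk_compl_of_infinite B hBlt
  have hbex : Nonempty (M ⊕ (M ⊕ PUnit.{u+1}) ↪ (Bᶜ : Set κ)) := by
    rw [← Cardinal.le_def, hBc]
    refine le_of_lt ?_
    simp only [Cardinal.mk_sum, Cardinal.lift_id, Cardinal.mk_fintype]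
    refine Cardinal.add_lt_of_lt hκ hlt (Cardinal.add_lt_of_lt hκ hlt ?_)
    refine lt_of_lt_of_le ?_ hκ
    simp
  obtain ⟨b⟩ := hbex
  have hbne : ∀ {x y} {k : κ}, (b x).1 = k → (b y).1 = k → x = y := by
    intro x y k hx hy
    exact b.injective (Subtype.ext (hx.trans hy.symm))
  have hp : ∀ β : M → κ, Function.Injective β → ∃ p : (sig C).V → W.V, IsEmb (sig C) W p ∧
      (∀ i a, ¬ Iso (C i) S → p (sin i a) = pr (sin i a)) ∧
      ∀ i (hi : Iso (C i) S) a, ∃ s, p (sin i a) = pl (sin (β ⟨i, hi⟩) s) := by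
    intro β hβ
    have : ∀ i, ∃ p : (C i).V → W.V, IsEmb (C i) W p ∧
      (¬ Iso (C i) S → ∀ a, p a = pr (sin i a)) ∧
      ∀ (hi : Iso (C i) S) a, ∃ s, p a = pl (sin (β ⟨i, hi⟩) s) := by
      intro i
      by_cases hi : Iso (C i) S
      · obtain ⟨e, he⟩ := hi.le
        refine ⟨fun a => pl (sin (β ⟨i, hi⟩) (e a)), (isEmb_pl _ _).comp
          ((isEmb_incl (C := fun _ : κ => S) (β ⟨i, hi⟩)).comp he), fun h => absurd hi h, 
          fun _ a => ⟨e a, rfl⟩⟩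
      · refine ⟨fun a => pr (sin i a), (isEmb_pr _ _).comp (isEmb_incl i), fun _ _ => rfl,
          fun h => absurd h hi⟩
    choose p hp1 hp2 hp3 using this
    refine ⟨_, isEmb_desc p hp1 ?_, fun i a hi => hp2 i hi a, fun i hi a => hp3 i hi a⟩
    intro i j x y hxy
    by_cases hi : Iso (C i) S <;> by_cases hj : Iso (C j) S
    · obtain ⟨s, hs⟩ := hp3 i hi x
      obtain ⟨t, ht⟩ := hp3 j hj y
      rw [hs, ht] at hxy
      exact congrArg Subtype.val (hβ (sin_inj_idx ((isEmb_pl _ _).1 hxy)))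
    · obtain ⟨s, hs⟩ := hp3 i hi x
      rw [hs, hp2 j hj y] at hxy
      exact absurd hxy (pl_ne_pr _ _)
    · obtain ⟨t, ht⟩ := hp3 j hj y
      rw [ht, hp2 i hi] at hxy
      exact absurd hxy.symm (pl_ne_pr _ _)
    · rw [hp2 j hj, hp2 i hi] at hxy
      exact sin_inj_idx ((isEmb_pr _ _).1 hxy)
  obtain ⟨p, hp1, hp2, hp3⟩ := hp (fun m => (b (Sum.inl m)).1) (by
    intro x y hxy; simpa using hbne hxy rfl)
  obtain ⟨p2, hq1, hq2, hq3⟩ := hp (fun m => (b (Sum.inr (Sum.inl m))).1) (by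
    intro x y hxy; simpa using hbne hxy rfl)
  obtain ⟨p', hp', hp'l, hp'r⟩ := exists_emb_plus (A := S) (B := sig C) (X := W)
    (f := fun s => pl (sin (b (Sum.inr (Sum.inr PUnit.unit))).1 s)) (g := p2)
    ((isEmb_pl _ _).comp (isEmb_incl (C := fun _ : κ => S) _)) hq1 (by
      intro s x hsx
      obtain ⟨i, a, rfl⟩ := exists_sin x
      by_cases hi : Iso (C i) S
      · obtain ⟨t, ht⟩ := hq3 i hi a
        rw [ht] at hsx
        have := hbne (sin_inj_idx ((isEmb_pl _ _).1 hsx)) rfl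
        simp at this
      · rw [hq2 i a hi] at hsx
        exact pl_ne_pr _ _ hsx)
  have hp'prop : ∀ x, (∃ y, p' x = pr y) ∨ ∃ z s, p' x = pl (sin (b (Sum.inr z)).1 s) := by
    rintro (s | x)
    · exact Or.inr ⟨_, _, hp'l s⟩
    · have hx : p' (Sum.inr x) = p2 x := hp'r x
      rw [hx]
      obtain ⟨i, a, rfl⟩ := exists_sin x
      by_cases hi : Iso (C i) S
      · obtain ⟨t, ht⟩ := hq3 i hi a
        exact Or.inr ⟨_, _, ht⟩
      · exact Or.inl ⟨_, hq2 i a hi⟩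
  have hgp' : IsEmb (plus S (sig C)) (sig C) (fun x => g (p' x)) := hg.comp hp'
  have hgp : IsEmb (sig C) (sig C) (fun x => g (p x)) := hg.comp hp1
  have hin : ∀ y : (sig C).V, Iso (C (sidx y)) S → ¬ Iso (C (sidx (g (p y)))) S ∧
      ∃ m s, p y = pl (sin (b (Sum.inl m)).1 s) := by
    intro y hy
    obtain ⟨i, a, rfl⟩ := exists_sin y
    obtain ⟨t, ht⟩ := hp3 i hy a
    refine ⟨?_, _, _, ht⟩
    rw [ht, hfk]
    exact (b (Sum.inl ⟨i, hy⟩)).2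
  let u : (plus S (sig C)).V → (sig C).V := fun x =>
    if Iso (C (sidx (g (p' x)))) S then g (p (g (p' x))) else g (p' x)
  have hcross : ∀ x y, ¬ Iso (C (sidx (g (p' x)))) S → Iso (C (sidx (g (p' y)))) S →
      g (p' x) ≠ g (p (g (p' y))) := by
    intro x y hx hy hxy
    have h1 := hg.1 hxy
    obtain ⟨m, s, hms⟩ := (hin _ hy).2
    rw [hms] at h1
    rcases hp'prop x with ⟨z, hz⟩ | ⟨z, s, hz⟩
    · rw [hz] at h1
      exact pl_ne_pr _ _ h1.symm
    · rw [hz] at h1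
      have := hbne (sin_inj_idx ((isEmb_pl _ _).1 h1)) rfl
      simp at this
  refine le_sig_sub (u := u) ⟨?_, ?_, ?_⟩ (fun i => ¬ Iso (C i) S) ?_
  · intro x y hxy
    simp only [u] at hxy
    split_ifs at hxy with h1 h2 h2
    · exact hgp'.1 (hgp.1 hxy)
    · exact absurd hxy.symm (hcross _ _ h2 h1)
    · exact absurd hxy (hcross _ _ h1 h2)
    · exact hgp'.1 hxy
  · intro x y hxy
    have h1 := hgp'.2.1 x y hxy
    have h2 := sig_adj_fst h1
    simp only [u]
    rw [h2]
    split_ifs with h3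
    · exact hgp.2.1 _ _ h1
    · exact h1
  · intro x
    simp only [u]
    split_ifs with h3
    · exact (hgp'.2.2 x).trans (hgp.2.2 _)
    · exact hgp'.2.2 x
  · intro x
    simp only [u]
    split_ifs with h3
    · exact (hin _ h3).1
    · exact h3

end Union

section Union2

open Cardinal

variable {P : Type u} [PartialOrder P] {I J : Type u} {C : I → CG P} {D : J → CG P}

theorem mult_eq_of_iso (hC : ∀ i, Conn (C i)) (hD : ∀ i, Conn (D i)) (h : Iso (sig C) (sig D))
    (S : CG P) : mult C S = mult D S := by
  obtain ⟨e, he⟩ := iso_sig_elim hC hD h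
  refine Cardinal.mk_congr (Equiv.subtypeEquiv e fun i => ?_)
  exact ⟨fun hi => (he i).symm.trans hi, fun hi => (he i).trans hi⟩

/-- add one component -/
def addC (S : CG P) (F : Σ I : Type u, I → CG P) : Σ I : Type u, I → CG P :=
  ⟨Option F.1, fun o => o.elim S F.2⟩

theorem le_addC (S : CG P) (F : Σ I : Type u, I → CG P) : Le (sig F.2) (sig (addC S F).2) :=
  sig_le_of (D := (addC S F).2) (fun i => some i) (Option.some_injective _) (fun i => Le.refl _)

theorem addC_le (S : CG P) (F : Σ I : Type u, I → CG P) :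
    Le (sig (addC S F).2) (plus S (sig F.2)) := by
  refine ⟨_, isEmb_desc (C := (addC S F).2) (fun o => match o with
    | none => fun a => pl a
    | some i => fun a => pr (sin i a)) ?_ ?_⟩
  · rintro (_ | i)
    · exact isEmb_pl _ _
    · exact (isEmb_pr _ _).comp (isEmb_incl i)
  · rintro (_ | i) (_ | j) a b hab
    · rfl
    · exact absurd hab (pl_ne_pr _ _)
    · exact absurd hab.symm (pl_ne_pr _ _)
    · exact congrArg some (sin_inj_idx ((isEmb_pr _ _).1 hab))

theorem mult_addC (S : CG P) (F : Σ I : Type u, I → CG P) :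
    mult (addC S F).2 S = mult F.2 S + 1 := by
  unfold mult
  rw [← Cardinal.mk_option]
  refine Cardinal.mk_congr ⟨fun o => match o with
    | ⟨none, _⟩ => none
    | ⟨some i, h⟩ => some ⟨i, h⟩, fun o => match o with
    | none => ⟨none, Iso.refl S⟩
    | some i => ⟨some i.1, i.2⟩, ?_, ?_⟩
  · rintro ⟨(_ | i), h⟩ <;> rfl
  · rintro (_ | i) <;> rfl

def ManyTwins (C : I → CG P) (D : J → CG P) : Prop :=
  ∃ F : ℕ → Σ I : Type u, I → CG P, (∀ k i, Conn ((F k).2 i)) ∧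
    (∀ k, Eqv (sig C) (sig (F k).2)) ∧ (∀ k l, k ≠ l → ¬ Iso (sig (F k).2) (sig (F l).2)) ∧
    ∀ k i, (∃ j, Le (C j) ((F k).2 i)) ∨ ∃ j, Le (D j) ((F k).2 i)

theorem ManyTwins.symm (h : Eqv (sig C) (sig D)) (hm : ManyTwins D C) : ManyTwins C D := by
  obtain ⟨F, h1, h2, h3, h4⟩ := hm
  exact ⟨F, h1, fun k => h.trans (h2 k), h3, fun k i => (h4 k i).symm⟩

/-- family version of step one -/
theorem step_one (hC : ∀ i, Conn (C i)) {S : CG P} (hS : Conn S)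
    (habs : Le (plus S (sig C)) (sig C)) (hfin : mult C S < ℵ₀) :
    ∃ F : ℕ → Σ I : Type u, I → CG P, (∀ k i, Conn ((F k).2 i)) ∧
    (∀ k, Eqv (sig C) (sig (F k).2)) ∧ (∀ k l, k ≠ l → ¬ Iso (sig (F k).2) (sig (F l).2)) ∧
    ∀ k i, (∃ j, (F k).2 i = C j) ∨ (F k).2 i = S := by
  let F : ℕ → Σ I : Type u, I → CG P := fun k => (addC S)^[k] ⟨I, C⟩
  have hF : ∀ k, F (k + 1) = addC S (F k) := fun k => Function.iterate_succ_apply' _ _ _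
  have hconn : ∀ k i, Conn ((F k).2 i) := by
    intro k
    induction k with
    | zero => exact hC
    | succ k ih =>
      rw [hF]
      rintro (_ | i)
      · exact hS
      · exact ih i
  have hmul : ∀ k, mult (F k).2 S = mult C S + k := by
    intro k
    induction k with
    | zero =>
      simp only [Nat.cast_zero, add_zero]
      rfl
    | succ k ih =>
      rw [hF, mult_addC, ih]
      push_cast
      rw [add_assoc]
  refine ⟨F, hconn, ?_, ?_, ?_⟩
  · intro k
    induction k with
    | zero => exact Eqv.refl _
    | succ k ih =>
      rw [hF]
      exact ⟨ih.1.trans (le_addC _ _), (addC_le _ _).trans ((plus_mono (Le.refl _) ih.2).trans habs)⟩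
  · intro k l hkl hiso
    have := mult_eq_of_iso (hconn k) (hconn l) hiso S
    rw [hmul, hmul] at this
    obtain ⟨n, hn⟩ := Cardinal.lt_aleph0.1 hfin
    rw [hn] at this
    norm_cast at this
    omega
  · intro k
    induction k with
    | zero => exact fun i => Or.inl ⟨i, rfl⟩
    | succ k ih =>
      rw [hF]
      rintro (_ | i)
      · exact Or.inr rfl
      · exact ih i

theorem mult_case (hC : ∀ i, Conn (C i)) (h : Eqv (sig C) (sig D))
    {S : CG P} (hS : Conn S) (hSS : ¬ Le (plus S S) S) (hmem : (∃ i, C i = S) ∨ ∃ j, D j = S)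
    (habs : Le (plus S (sig C)) (sig C)) (hlt : mult C S < ℵ₀ ∨ mult C S < mult D S) :
    ManyTwins C D := by
  have hmemLe : (∃ j, Le (C j) S) ∨ ∃ j, Le (D j) S := by
    rcases hmem with ⟨i, rfl⟩ | ⟨i, rfl⟩
    · exact Or.inl ⟨i, Le.refl _⟩
    · exact Or.inr ⟨i, Le.refl _⟩
  by_cases hfin : mult C S < ℵ₀
  · obtain ⟨F, h1, h2, h3, h4⟩ := step_one hC hS habs hfin
    refine ⟨F, h1, h2, h3, fun k i => ?_⟩
    rcases h4 k i with ⟨j, hj⟩ | hj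
    · exact Or.inl ⟨j, hj ▸ Le.refl _⟩
    · rw [hj]; exact hmemLe
  · have hlt' := hlt.resolve_left hfin
    have key := step_two hC h hS hSS hlt' ((not_lt.1 hfin).trans hlt'.le)
    have hsub : Le (sig (fun i : {i // ¬ Iso (C i) S} => C i)) (sig C) :=
      sig_le_of (fun i => i.1) Subtype.val_injective (fun i => Le.refl _)
    have heqv : Eqv (sig C) (sig (fun i : {i // ¬ Iso (C i) S} => C i)) :=
      ⟨(le_plus_right _ _).trans key, hsub⟩
    obtain ⟨F, h1, h2, h3, h4⟩ := step_one (C := fun i : {i // ¬ Iso (C i) S} => C i)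
      (fun i => hC i) hS ((plus_mono (Le.refl _) hsub).trans key) (by
        have : mult (fun i : {i // ¬ Iso (C i) S} => C i) S = 0 := by
          unfold mult
          rw [Cardinal.mk_eq_zero_iff]
          exact ⟨fun i => i.1.2 i.2⟩
        rw [this]
        exact Cardinal.aleph0_pos)
    refine ⟨F, h1, fun k => heqv.trans (h2 k), h3, fun k i => ?_⟩
    rcases h4 k i with ⟨j, hj⟩ | hj
    · exact Or.inl ⟨j, hj ▸ Le.refl _⟩
    · rw [hj]; exact hmemLe

theorem periodic_of_essential {h : (sig C).V → (sig C).V} (hh : IsEmb (sig C) (sig C) h)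
    {f : I → I} (hf : ∀ x, sidx (h x) = f (sidx x)) {i : I}
    (hi : ¬ Le (plus (C i) (sig C)) (sig C)) : ∃ n, f^[n+1] i = i := by
  classical
  by_contra hcon
  push Not at hcon
  apply hi
  let T : Set I := {j | ∃ n, f^[n] i = j}
  have hT : ∀ j ∈ T, f j ∈ T := by
    rintro _ ⟨n, rfl⟩
    exact ⟨n + 1, Function.iterate_succ_apply' _ _ _⟩
  have hTi : ∀ j ∈ T, f j ≠ i := by
    rintro _ ⟨n, rfl⟩
    rw [← Function.iterate_succ_apply' f]
    exact hcon n
  let h' : (sig C).V → (sig C).V := fun x => if sidx x ∈ T then h x else x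
  have hemb : IsEmb (sig C) (sig C) h' := by
    refine ⟨?_, ?_, ?_⟩
    · intro x y hxy
      simp only [h'] at hxy
      split_ifs at hxy with h1 h2 h2
      · exact hh.1 hxy
      · exact absurd (by rw [← hxy, hf]; exact hT _ h1) h2
      · exact absurd (by rw [hxy, hf]; exact hT _ h2) h1
      · exact hxy
    · intro x y hxy
      simp only [h', sig_adj_fst hxy]
      split_ifs
      · exact hh.2.1 _ _ hxy
      · exact hxy
    · intro x
      simp only [h']
      split_ifs
      · exact hh.2.2 x
      · exact le_rfl
  refine plus_le (isEmb_incl i) hemb ?_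
  intro a x hax
  simp only [h'] at hax
  split_ifs at hax with h1
  · have := congrArg sidx hax
    rw [hf, sidx_sin] at this
    exact hTi _ h1 this.symm
  · apply h1
    rw [← hax]
    exact ⟨0, rfl⟩

theorem class_le (hC : ∀ i, Conn (C i)) (hD : ∀ i, Conn (D i)) (h : Eqv (sig C) (sig D))
    {S : CG P} (hess : ¬ Le (plus S (sig C)) (sig C)) :
    ∃ f : {i // Eqv (C i) S} → {j // Eqv (D j) S}, Function.Injective f := by
  obtain ⟨⟨φ, hφ⟩, ⟨ψ, hψ⟩⟩ := h
  obtain ⟨f, hf⟩ := exists_compMap (D := D) hC hφ.2.1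
  obtain ⟨g, hg⟩ := exists_compMap (D := C) hD hψ.2.1
  have hper : ∀ i, Eqv (C i) S → ∃ n, (fun i => g (f i))^[n+1] i = i := by
    intro i hi
    refine periodic_of_essential (hψ.comp hφ) (f := fun i => g (f i)) ?_ ?_
    · intro x
      simp [hf, hg]
    · intro hle
      exact hess ((plus_mono hi.2 (Le.refl _)).trans hle)
  have hup : ∀ i n, Le (C i) (C ((fun i => g (f i))^[n] i)) := by
    intro i n
    induction n with
    | zero => exact Le.refl _
    | succ n ih =>
      rw [Function.iterate_succ_apply']
      exact ih.trans ((le_of_compMap hφ hf _).trans (le_of_compMap hψ hg _))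
  refine ⟨fun i => ⟨f i.1, ?_⟩, ?_⟩
  · obtain ⟨n, hn⟩ := hper i.1 i.2
    have h1 := hup (g (f i.1)) n
    rw [Function.iterate_succ_apply] at hn
    rw [hn] at h1
    exact ⟨((le_of_compMap hψ hg _).trans h1).trans i.2.1, i.2.2.trans (le_of_compMap hφ hf _)⟩
  · rintro ⟨i, hi⟩ ⟨j, hj⟩ hij
    have hij' : f i = f j := congrArg Subtype.val hij
    apply Subtype.ext
    change i = j
    set t := fun i => g (f i) with ht
    obtain ⟨n, hn⟩ := hper i hi
    obtain ⟨m, hm⟩ := hper j hj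
    have hp1 : Function.IsPeriodicPt t (n+1) i := hn
    have hp2 : Function.IsPeriodicPt t (m+1) j := hm
    have hq1 : Function.IsPeriodicPt t ((n+1)*(m+1)) i := hp1.mul_const _
    have hq2 : Function.IsPeriodicPt t ((n+1)*(m+1)) j := hp2.const_mul _
    have htij : t i = t j := by simp only [ht, hij']
    have hpos : (n+1)*(m+1) = ((n+1)*(m+1) - 1) + 1 := by
      have : 0 < (n+1)*(m+1) := by positivity
      omega
    have e1 : t^[(n+1)*(m+1)] i = i := hq1
    have e2 : t^[(n+1)*(m+1)] j = j := hq2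
    rw [hpos, Function.iterate_succ_apply] at e1 e2
    rw [← e1, ← e2, htij]

/-- `C` has infinitely many pairwise non-isomorphic connected equimorphic copies as soon as
it has a connected twin. -/
def Alt (C : CG P) : Prop :=
  ∀ D, Conn D → Eqv C D → ¬ Iso C D →
    ∃ T : ℕ → CG P, (∀ k, Conn (T k)) ∧ (∀ k, Eqv C (T k)) ∧ ∀ k l, k ≠ l → ¬ Iso (T k) (T l)

theorem alt_case (hC : ∀ i, Conn (C i)) (hAlt : ∀ i, Alt (C i)) {i : I} {E : CG P} (hE : Conn E)
    (hiE : Eqv (C i) E) (hn : ¬ Iso (C i) E) : ManyTwins C D := by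
  classical
  obtain ⟨T, hT1, hT2, hT3⟩ := hAlt i E hE hiE hn
  refine ⟨fun k => ⟨I, fun j => if Eqv (C j) (C i) then T k else C j⟩, ?_, ?_, ?_, ?_⟩
  · intro k j
    dsimp only
    split_ifs
    · exact hT1 k
    · exact hC j
  · intro k
    refine ⟨sig_le_of id Function.injective_id fun j => ?_,
      sig_le_of id Function.injective_id fun j => ?_⟩
    · dsimp only [id]
      split_ifs with hj
      · exact hj.1.trans (hT2 k).1
      · exact Le.refl _
    · dsimp only [id]
      split_ifs with hj
      · exact (hT2 k).2.trans hj.2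
      · exact Le.refl _
  · intro k l hkl hiso
    obtain ⟨e, he⟩ := iso_sig_elim (by
      intro j
      dsimp only
      split_ifs
      · exact hT1 k
      · exact hC j) (by
      intro j
      dsimp only
      split_ifs
      · exact hT1 l
      · exact hC j) hiso
    have h1 := he i
    dsimp only at h1
    rw [if_pos (Eqv.refl _)] at h1
    split_ifs at h1 with h2
    · exact hT3 k l hkl h1
    · exact h2 (((hT2 k).trans h1.eqv).symm)
  · intro k j
    left
    refine ⟨j, ?_⟩
    dsimp only
    split_ifs with hj
    · exact hj.1.trans (hT2 k).1
    · exact Le.refl _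

theorem iso_of_mult (h : ∀ S, mult C S = mult D S) : Iso (sig C) (sig D) := by
  let st : Setoid (CG P) := ⟨Iso, Iso.refl, Iso.symm, Iso.trans⟩
  have : ∀ q : Quotient st, Nonempty ({i // (⟦C i⟧ : Quotient st) = q} ≃ 
      {j // (⟦D j⟧ : Quotient st) = q}) := by
    intro q
    obtain ⟨S, rfl⟩ := Quotient.exists_rep q
    rw [← Cardinal.eq]
    have := h S
    unfold mult at this
    have e1 : ∀ A : CG P, ((⟦A⟧ : Quotient st) = ⟦S⟧) = Iso A S := fun A =>
      propext ⟨fun h => Quotient.exact h, fun h => Quotient.sound h⟩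
    simp only [e1]
    exact this
  have e := fun q => Classical.choice (this q)
  let e' : I ≃ J := ((Equiv.sigmaFiberEquiv (fun i => (⟦C i⟧ : Quotient st))).symm.trans
    (Equiv.sigmaCongrRight e)).trans (Equiv.sigmaFiberEquiv (fun j => (⟦D j⟧ : Quotient st)))
  refine iso_sig_intro e' fun i => ?_
  have h1 : (⟦D (e' i)⟧ : Quotient st) = ⟦C i⟧ := (e _ ⟨i, rfl⟩).2
  exact (Quotient.exact h1 : Iso _ _).symm

theorem union_lemma (hC : ∀ i, Conn (C i)) (hD : ∀ i, Conn (D i)) (h : Eqv (sig C) (sig D))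
    (hn : ¬ Iso (sig C) (sig D)) (hAlt : ∀ i, Alt (C i))
    (hCC : ∀ i, ¬ Le (plus (C i) (C i)) (C i)) (hDD : ∀ i, ¬ Le (plus (D i) (D i)) (D i)) :
    ManyTwins C D := by
  by_contra hmany
  apply hn
  have key : ∀ S, ((∃ i, C i = S) ∨ ∃ j, D j = S) → mult C S = mult D S := by
    intro S hmem
    have hS : Conn S := by
      rcases hmem with ⟨i, rfl⟩ | ⟨i, rfl⟩
      · exact hC i
      · exact hD i
    have hSS : ¬ Le (plus S S) S := by
      rcases hmem with ⟨i, rfl⟩ | ⟨i, rfl⟩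
      · exact hCC i
      · exact hDD i
    by_cases habs : Le (plus S (sig C)) (sig C)
    · have habs' : Le (plus S (sig D)) (sig D) :=
        (plus_mono (Le.refl _) h.2).trans (habs.trans h.1)
      rcases lt_trichotomy (mult C S) (mult D S) with h1 | h1 | h1
      · exact absurd (mult_case hC h hS hSS hmem habs (Or.inr h1)) hmany
      · exact h1
      · exact absurd (ManyTwins.symm h
          (mult_case hD h.symm hS hSS hmem.symm habs' (Or.inr h1))) hmany
    · have habs' : ¬ Le (plus S (sig D)) (sig D) := fun hle => habs
        ((plus_mono (Le.refl _) h.1).trans (hle.trans h.2))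
      obtain ⟨f, hf⟩ := class_le hC hD h habs
      obtain ⟨g, hg⟩ := class_le hD hC h.symm habs'
      obtain ⟨i, hi⟩ : ∃ i, Eqv (C i) S := by
        rcases hmem with ⟨i, hi⟩ | ⟨j, hj⟩
        · exact ⟨i, hi ▸ Eqv.refl _⟩
        · exact ⟨(g ⟨j, hj ▸ Eqv.refl _⟩).1, (g ⟨j, hj ▸ Eqv.refl _⟩).2⟩
      have hall : ∀ E, Conn E → Eqv E S → Iso (C i) E := by
        intro E hE hES
        by_contra hne
        exact hmany (alt_case hC hAlt hE (hi.trans hES.symm) hne)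
      have hall' : ∀ E, Conn E → (Iso E S ↔ Eqv E S) := fun E hE =>
        ⟨Iso.eqv, fun hES => (hall E hE hES).symm.trans (hall S hS (Eqv.refl _))⟩
      unfold mult
      simp only [fun i => hall' (C i) (hC i), fun i => hall' (D i) (hD i)]
      exact le_antisymm (Cardinal.mk_le_of_injective hf) (Cardinal.mk_le_of_injective hg)
  refine iso_of_mult fun S => ?_
  have hm : ∀ S S', Iso S S' → mult C S = mult C S' ∧ mult D S = mult D S' := by
    intro S S' hSS'
    constructor
    · exact Cardinal.mk_congr (Equiv.subtypeEquivRight fun i =>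
        ⟨fun h => h.trans hSS', fun h => h.trans hSS'.symm⟩)
    · exact Cardinal.mk_congr (Equiv.subtypeEquivRight fun i =>
        ⟨fun h => h.trans hSS', fun h => h.trans hSS'.symm⟩)
  by_cases h1 : ∃ i, Iso (C i) S
  · obtain ⟨i, hi⟩ := h1
    rw [← (hm _ _ hi).1, ← (hm _ _ hi).2]
    exact key _ (Or.inl ⟨i, rfl⟩)
  by_cases h2 : ∃ j, Iso (D j) S
  · obtain ⟨i, hi⟩ := h2
    rw [← (hm _ _ hi).1, ← (hm _ _ hi).2]
    exact key _ (Or.inr ⟨i, rfl⟩)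
  push Not at h1 h2
  unfold mult
  rw [Cardinal.mk_eq_zero_iff.2 ⟨fun i => h1 i.1 i.2⟩,
    Cardinal.mk_eq_zero_iff.2 ⟨fun i => h2 i.1 i.2⟩]

end Union2

section Sets

variable {V W : Type u} {G : SimpleGraph V} {H : SimpleGraph W}

/-- `X` is closed under adjacency inside `A`. -/
def Cl (G : SimpleGraph V) (A X : Set V) : Prop :=
  ∀ x ∈ A, x ∈ X → ∀ y ∈ A, G.Adj x y → y ∈ X

/-- `A` is a connected vertex set. -/
def CSet (G : SimpleGraph V) (A : Set V) : Prop :=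
  A.Nonempty ∧ ∀ X, (A ∩ X).Nonempty → Cl G A X → A ⊆ X

/-- the component of `b` in `A` -/
def cmp (G : SimpleGraph V) (A : Set V) (b : V) : Set V :=
  {x | x ∈ A ∧ ∀ X, b ∈ X → Cl G A X → x ∈ X}

theorem cmp_subset (A : Set V) (b : V) : cmp G A b ⊆ A := fun _ h => h.1

theorem self_mem_cmp {A : Set V} {b : V} (hb : b ∈ A) : b ∈ cmp G A b := ⟨hb, fun _ h _ => h⟩

theorem cmp_closed {A : Set V} {b x y : V} (hx : x ∈ cmp G A b) (hy : y ∈ A) (h : G.Adj x y) :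
    y ∈ cmp G A b :=
  ⟨hy, fun X hb hX => hX x hx.1 (hx.2 X hb hX) y hy h⟩

theorem cset_cmp {A : Set V} {b : V} (hb : b ∈ A) : CSet G (cmp G A b) := by
  refine ⟨⟨b, self_mem_cmp hb⟩, ?_⟩
  rintro X ⟨z, hz, hzX⟩ hX
  have hbX : b ∈ X := by
    by_contra hbX
    have := hz.2 (cmp G A b \ X) ⟨self_mem_cmp hb, hbX⟩ (by
      rintro x - ⟨hx, hxX⟩ y hy hxy
      have hy' := cmp_closed hx hy hxy
      exact ⟨hy', fun hyX => hxX (hX y hy' hyX x hx hxy.symm)⟩)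
    exact this.2 hzX
  intro x hx
  refine (hx.2 (cmp G A b ∩ X) ⟨self_mem_cmp hb, hbX⟩ ?_).2
  rintro x - ⟨hx, hxX⟩ y hy hxy
  have hy' := cmp_closed hx hy hxy
  exact ⟨hy', hX x hx hxX y hy' hxy⟩

theorem CSet.subset_cmp {A B : Set V} (hB : CSet G B) (hBA : B ⊆ A) {b : V} (hb : b ∈ B) :
    B ⊆ cmp G A b :=
  hB.2 _ ⟨b, hb, self_mem_cmp (hBA hb)⟩ fun _ _ hxX _ hy hxy => cmp_closed hxX (hBA hy) hxy

theorem cmp_subset_cmp {A : Set V} {x y : V} (hy : y ∈ cmp G A x) : cmp G A x ⊆ cmp G A y := by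
  have hx : x ∈ A := by
    by_contra hx
    exact (hy.2 Aᶜ hx (fun _ h h' => absurd h h')) hy.1
  exact (cset_cmp hx).subset_cmp (cmp_subset _ _) hy

theorem cset_insert {A : Set V} (hA : CSet G A) {y s : V} (hy : y ∈ A) (h : G.Adj y s) :
    CSet G (insert s A) := by
  refine ⟨⟨s, Or.inl rfl⟩, ?_⟩
  rintro X ⟨z, hz, hzX⟩ hX
  have h1 : (A ∩ X).Nonempty := by
    rcases hz with rfl | hz
    · exact ⟨y, hy, hX z (Or.inl rfl) hzX y (Or.inr hy) h.symm⟩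
    · exact ⟨z, hz, hzX⟩
  have h2 : A ⊆ X := hA.2 X h1 fun x hx hxX y hy hxy => hX x (Or.inr hx) hxX y (Or.inr hy) hxy
  rintro x (rfl | hx)
  · exact hX y (Or.inr hy) (h2 hy) x (Or.inl rfl) h
  · exact h2 hx

theorem cset_star {A : Set V} {s : V} (hs : s ∈ A)
    (h : ∀ x ∈ A, ∃ B ⊆ A, x ∈ B ∧ s ∈ B ∧ CSet G B) : CSet G A := by
  refine ⟨⟨s, hs⟩, ?_⟩
  rintro X ⟨z, hz, hzX⟩ hX
  have key : ∀ B ⊆ A, CSet G B → (B ∩ X).Nonempty → B ⊆ X := fun B hBA hB hBX =>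
    hB.2 X hBX fun x hx hxX y hy hxy => hX x (hBA hx) hxX y (hBA hy) hxy
  have hsX : s ∈ X := by
    obtain ⟨B, hBA, hzB, hsB, hB⟩ := h z hz
    exact key B hBA hB ⟨z, hzB, hzX⟩ hsB
  intro x hx
  obtain ⟨B, hBA, hxB, hsB, hB⟩ := h x hx
  exact key B hBA hB ⟨s, hsB, hsX⟩ hxB

theorem CSet.image {f : V → W} (hf : ∀ a b, G.Adj a b → H.Adj (f a) (f b)) {A : Set V}
    (hA : CSet G A) : CSet H (f '' A) := by
  refine ⟨hA.1.image f, ?_⟩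
  rintro X ⟨_, ⟨a, ha, rfl⟩, haX⟩ hX
  rw [Set.image_subset_iff]
  exact hA.2 (f ⁻¹' X) ⟨a, ha, haX⟩ fun x hx hxX y hy hxy =>
    hX _ ⟨x, hx, rfl⟩ hxX _ ⟨y, hy, rfl⟩ (hf _ _ hxy)

theorem connected_iff_cset : G.Connected ↔ CSet G Set.univ := by
  constructor
  · intro h
    obtain ⟨a0⟩ := h.nonempty
    refine ⟨⟨a0, trivial⟩, ?_⟩
    rintro X ⟨a, -, ha⟩ hX b -
    obtain ⟨w⟩ := h.preconnected b a
    induction w with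
    | nil => exact ha
    | cons hadj _ ih => exact hX _ trivial (ih ha) _ trivial hadj.symm
  · rintro ⟨⟨a0, -⟩, h⟩
    have : Nonempty V := ⟨a0⟩
    refine ⟨fun a b => ?_⟩
    exact h {x | G.Reachable a x} ⟨a, trivial, SimpleGraph.Reachable.refl _⟩
      (fun x _ hx y _ hxy => SimpleGraph.Reachable.trans hx hxy.reachable) (Set.mem_univ b)

theorem cset_iff_induce {A : Set V} : CSet G A ↔ (G.induce A).Connected := by
  rw [connected_iff_cset]
  constructor
  · rintro ⟨⟨a, ha⟩, h⟩
    refine ⟨⟨⟨a, ha⟩, trivial⟩, ?_⟩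
    rintro X ⟨z, -, hz⟩ hX
    have := h (Subtype.val '' X) ⟨z.1, z.2, z, hz, rfl⟩ (by
      rintro _ hx ⟨x, hxX, rfl⟩ y hy hxy
      exact ⟨⟨y, hy⟩, hX x trivial hxX ⟨y, hy⟩ trivial hxy, rfl⟩)
    rintro ⟨x, hx⟩ -
    obtain ⟨x', hx', rfl⟩ := this hx
    exact hx'
  · intro h
    have := CSet.image (H := G) (f := Subtype.val) (fun a b hab => hab) h
    simpa using this

/-- ray lemma -/
theorem exists_ray (big : Set V → Prop) (hmono : ∀ A B, A ⊆ B → big A → big B)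
    (h0 : ∃ A, big A ∧ CSet G A)
    (hstep : ∀ A, big A → CSet G A → ∀ v ∈ A, ∃ B ⊆ A \ {v}, big B ∧ CSet G B) :
    ¬ G.IsRayless := by
  intro hray
  apply hray
  let T := {p : Set V × V // big p.1 ∧ CSet G p.1 ∧ p.2 ∈ p.1}
  have hnext : ∀ p : T, ∃ q : T, q.1.1 ⊆ p.1.1 \ {p.1.2} ∧ G.Adj p.1.2 q.1.2 := by
    rintro ⟨⟨A, v⟩, hbig, hA, hv⟩
    obtain ⟨B, hBA, hB, hBc⟩ := hstep A hbig hA v hv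
    obtain ⟨b, hb⟩ := hBc.1
    have hBsub := hBc.subset_cmp hBA hb
    have hc := cset_cmp (G := G) (hBA hb)
    obtain ⟨x, hx, hxv⟩ : ∃ x ∈ cmp G (A \ {v}) b, G.Adj v x := by
      by_contra hcon
      push Not at hcon
      have := hA.2 (cmp G (A \ {v}) b) ⟨b, (hBA hb).1, self_mem_cmp (hBA hb)⟩ (by
        intro x hx hxX y hy hxy
        by_cases hyv : y = v
        · subst hyv
          exact absurd hxy.symm (hcon x hxX)
        · exact cmp_closed hxX ⟨hy, hyv⟩ hxy)
      exact (this hv).1.2 rfl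
    exact ⟨⟨⟨cmp G (A \ {v}) b, x⟩, hmono _ _ hBsub hB, hc, hx⟩, cmp_subset _ _, hxv⟩
  choose nxt hn1 hn2 using hnext
  obtain ⟨A, hbig, hA⟩ := h0
  obtain ⟨a, ha⟩ := hA.1
  let s : ℕ → T := fun n => nxt^[n] ⟨⟨A, a⟩, hbig, hA, ha⟩
  have hs : ∀ n, s (n + 1) = nxt (s n) := fun n => Function.iterate_succ_apply' _ _ _
  have hanti : Antitone fun n => (s n).1.1 := antitone_nat_of_succ_le fun n => by
    rw [hs]
    exact (hn1 (s n)).trans Set.sdiff_subset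
  have hne : ∀ m n, m < n → (s m).1.2 ≠ (s n).1.2 := by
    intro m n hmn heq
    have h1 : (s n).1.2 ∈ (s (m+1)).1.1 := hanti (show m + 1 ≤ n from hmn) (s n).2.2.2
    rw [hs] at h1
    exact (hn1 (s m) h1).2 heq.symm
  refine ⟨fun n => (s n).1.2, ?_, ?_⟩
  · intro m n hmn
    rcases lt_trichotomy m n with h | h | h
    · exact absurd hmn (hne _ _ h)
    · exact h
    · exact absurd hmn.symm (hne _ _ h)
  · intro n
    have := hn2 (s n)
    rw [← hs] at this
    exact this

theorem IsRayless_of_hom {f : V → W} (hf : Function.Injective f)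
    (hf' : ∀ a b, G.Adj a b → H.Adj (f a) (f b)) (hH : H.IsRayless) : G.IsRayless := by
  rintro ⟨r, hr, hr'⟩
  exact hH ⟨fun n => f (r n), hf.comp hr, fun n => hf' _ _ (hr' n)⟩

theorem not_plus_self_le {P : Type u} [PartialOrder P] {S : CG P} (hS : Conn S)
    (hray : S.G.IsRayless) : ¬ Le (plus S S) S := by
  rintro ⟨h, hh⟩
  have hl := hh.comp (isEmb_pl S S)
  have hr := hh.comp (isEmb_pr S S)
  have hd : ∀ a b, h (pl a) ≠ h (pr b) := fun a b hab => pl_ne_pr _ _ (hh.1 hab)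
  have hS' : CSet S.G Set.univ := connected_iff_cset.1 hS
  refine exists_ray (G := S.G) (fun A => ∃ g : S.V → S.V, IsEmb S S g ∧ ∀ x, g x ∈ A) ?_ ?_ ?_ hray
  · rintro A B hAB ⟨g, hg, hg'⟩
    exact ⟨g, hg, fun x => hAB (hg' x)⟩
  · exact ⟨Set.univ, ⟨_, IsEmb.refl S, fun _ => trivial⟩, hS'⟩
  · rintro A ⟨g, hg, hgA⟩ - v hv
    have : ∃ k, IsEmb S S k ∧ ∀ x, g (k x) ≠ v := by
      by_cases hv' : ∃ a, g (h (pl a)) = v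
      · obtain ⟨a, rfl⟩ := hv'
        exact ⟨_, hr, fun x hx => hd _ _ (hg.1 hx).symm⟩
      · push Not at hv'
        exact ⟨_, hl, hv'⟩
    obtain ⟨k, hk, hkv⟩ := this
    refine ⟨(fun x => g (k x)) '' Set.univ, ?_, ?_, ?_⟩
    · rintro _ ⟨x, -, rfl⟩
      exact ⟨hgA _, hkv x⟩
    · exact ⟨_, hg.comp hk, fun x => ⟨x, trivial, rfl⟩⟩
    · exact hS'.image (hg.comp hk).2.1

end Sets

section Ideals

/-- a class of graphs -/
abbrev GClass := Set (Σ V : Type u, SimpleGraph V)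

variable {V W : Type u} {G : SimpleGraph V} {H : SimpleGraph W} {Q : GClass.{u}}

def QS (Q : GClass.{u}) (G : SimpleGraph V) (A : Set V) : Prop :=
  (⟨A, G.induce A⟩ : Σ V : Type u, SimpleGraph V) ∈ Q

structure Ideal (Q : GClass.{u}) : Prop where
  hom : ∀ (V W : Type u) (G : SimpleGraph V) (H : SimpleGraph W) (f : V → W),
    Function.Injective f → (∀ a b, G.Adj a b → H.Adj (f a) (f b)) →
    (⟨W, H⟩ : Σ V : Type u, SimpleGraph V) ∈ Q → (⟨V, G⟩ : Σ V : Type u, SimpleGraph V) ∈ Q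
  union : ∀ (V : Type u) (G : SimpleGraph V) (A B : Set V),
    (∀ x ∈ A, ∀ y ∈ B, G.Adj x y → y ∈ A) → QS Q G A → QS Q G B → QS Q G (A ∪ B)
  add : ∀ (V : Type u) (G : SimpleGraph V) (A : Set V) (s : V), QS Q G A → QS Q G (insert s A)

theorem Ideal.map (hQ : Ideal Q) {A : Set V} {B : Set W} {f : V → W} (hf : Set.InjOn f A)
    (hadj : ∀ a ∈ A, ∀ b ∈ A, G.Adj a b → H.Adj (f a) (f b)) (hm : ∀ a ∈ A, f a ∈ B)
    (h : QS Q H B) : QS Q G A := by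
  refine hQ.hom _ _ _ _ (fun a : A => (⟨f a.1, hm a.1 a.2⟩ : B)) ?_ ?_ h
  · rintro ⟨a, ha⟩ ⟨b, hb⟩ hab
    exact Subtype.ext (hf ha hb (congrArg Subtype.val hab))
  · rintro ⟨a, ha⟩ ⟨b, hb⟩ hab
    exact hadj a ha b hb hab

theorem Ideal.mono (hQ : Ideal Q) {A B : Set V} (hAB : A ⊆ B) (h : QS Q G B) : QS Q G A :=
  hQ.map (f := fun x => x) (fun _ _ _ _ h => h) (fun _ _ _ _ h => h) hAB h

theorem Ideal.univ (hQ : Ideal Q) :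
    QS Q G Set.univ ↔ (⟨V, G⟩ : Σ V : Type u, SimpleGraph V) ∈ Q := by
  constructor
  · intro h
    exact hQ.hom _ _ _ _ (fun a : V => (⟨a, trivial⟩ : (Set.univ : Set V)))
      (fun a b hab => congrArg Subtype.val hab) (fun a b hab => hab) h
  · intro h
    exact hQ.hom _ _ _ _ Subtype.val Subtype.val_injective (fun a b hab => hab) h

def Good (Q : GClass.{u}) (G : SimpleGraph V) (S : Set V) : Prop :=
  S.Finite ∧ ∀ B, CSet G B → Disjoint B S → QS Q G B

def next (Q : GClass.{u}) : GClass.{u} := {g | ∃ S, Good Q g.2 S}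

theorem good_comap (hQ : Ideal Q) {f : V → W} (hf : Function.Injective f)
    (hadj : ∀ a b, G.Adj a b → H.Adj (f a) (f b)) {S : Set W} (hS : Good Q H S) :
    Good Q G (f ⁻¹' S) := by
  refine ⟨hS.1.preimage hf.injOn, fun B hB hd => ?_⟩
  refine hQ.map (f := f) hf.injOn (fun a _ b _ => hadj a b) (fun a ha => Set.mem_image_of_mem f ha)
    (hS.2 (f '' B) (hB.image hadj) ?_)
  rw [Set.disjoint_left]
  rintro _ ⟨a, ha, rfl⟩ haS
  exact Set.disjoint_left.1 hd ha haS

theorem cset_preimage {A B : Set V} (hB : CSet G B) (hBA : B ⊆ A) :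
    CSet (G.induce A) (Subtype.val ⁻¹' B) := by
  obtain ⟨⟨b, hb⟩, h⟩ := hB
  refine ⟨⟨⟨b, hBA hb⟩, hb⟩, ?_⟩
  rintro X ⟨z, hz, hzX⟩ hX
  have := h (Subtype.val '' X) ⟨z.1, hz, z, hzX, rfl⟩ (by
    rintro _ hx ⟨x, hxX, rfl⟩ y hy hxy
    exact ⟨⟨y, hBA hy⟩, hX x hx hxX ⟨y, hBA hy⟩ hy hxy, rfl⟩)
  rintro x hx
  obtain ⟨x', hx', h⟩ := this hx
  rwa [← Subtype.ext h]

theorem qs_next (hQ : Ideal Q) {A : Set V} : QS (next Q) G A ↔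
    ∃ S : Set V, S.Finite ∧ ∀ B ⊆ A, CSet G B → Disjoint B S → QS Q G B := by
  constructor
  · rintro ⟨S, hS, h⟩
    refine ⟨Subtype.val '' S, hS.image _, fun B hBA hB hd => ?_⟩
    have := h _ (cset_preimage hB hBA) (by
      rw [Set.disjoint_left]
      intro x hx hxS
      exact Set.disjoint_left.1 hd hx ⟨x, hxS, rfl⟩)
    refine hQ.hom _ _ _ _ (fun b : B => (⟨⟨b.1, hBA b.2⟩, b.2⟩ : (Subtype.val ⁻¹' B : Set A)))
      ?_ ?_ this
    · intro a b hab
      apply Subtype.ext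
      exact congrArg (fun x => x.1.1) hab
    · intro a b hab
      exact hab
  · rintro ⟨S, hS, h⟩
    refine ⟨Subtype.val ⁻¹' S, hS.preimage Subtype.val_injective.injOn, fun B hB hd => ?_⟩
    refine hQ.map (f := Subtype.val) Subtype.val_injective.injOn (fun a _ b _ h => h)
      (fun a ha => Set.mem_image_of_mem _ ha) (h (Subtype.val '' B) ?_
        (CSet.image (G := G.induce A) (f := Subtype.val) (fun _ _ h => h) hB) ?_)
    · rintro _ ⟨a, -, rfl⟩
      exact a.2
    · rw [Set.disjoint_left]
      rintro _ ⟨a, ha, rfl⟩ haS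
      exact Set.disjoint_left.1 hd ha haS

theorem Ideal.next (hQ : Ideal Q) : Ideal (next Q) := by
  refine ⟨?_, ?_, ?_⟩
  · rintro V W G H f hf hadj ⟨S, hS⟩
    exact ⟨_, good_comap hQ hf hadj hS⟩
  · intro V G A B hAB hA hB
    rw [qs_next hQ] at *
    obtain ⟨S, hS, h⟩ := hA
    obtain ⟨S', hS', h'⟩ := hB
    refine ⟨S ∪ S', hS.union hS', fun C hC hCc hd => ?_⟩
    rw [Set.disjoint_union_right] at hd
    by_cases hne : (C ∩ A).Nonempty
    · refine h C (hCc.2 A hne ?_) hCc hd.1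
      intro x hx hxA y hy hxy
      rcases hC hy with hyA | hyB
      · exact hyA
      · exact hAB x hxA y hyB hxy
    · refine h' C (fun x hx => ?_) hCc hd.2
      rcases hC hx with hxA | hxB
      · exact absurd ⟨x, hx, hxA⟩ hne
      · exact hxB
  · intro V G A s hA
    rw [qs_next hQ] at *
    obtain ⟨S, hS, h⟩ := hA
    refine ⟨insert s S, hS.insert s, fun C hC hCc hd => ?_⟩
    rw [Set.disjoint_left] at hd
    refine h C (fun x hx => ?_) hCc ?_
    · rcases hC hx with rfl | hxA
      · exact absurd (Set.mem_insert _ _) (hd hx)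
      · exact hxA
    · rw [Set.disjoint_left]
      exact fun x hx hxS => hd hx (Or.inr hxS)

theorem Ideal.subset_next (hQ : Ideal Q) : Q ⊆ RT.next Q := by
  rintro ⟨V, G⟩ h
  exact ⟨∅, Set.finite_empty, fun B _ _ => hQ.mono (Set.subset_univ B) (hQ.univ.2 h)⟩

theorem good_inter (hQ : Ideal Q) {S S' : Set V} (hS : Good Q G S) (hS' : Good Q G S') :
    Good Q G (S ∩ S') := by
  refine ⟨hS.1.subset Set.inter_subset_left, fun A hA hd => ?_⟩
  rw [Set.disjoint_left] at hd
  set Z := A ∩ (S ∪ S') with hZ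
  set R := A \ Z with hR
  have hRS : ∀ x ∈ R, x ∉ S ∧ x ∉ S' := by
    intro x hx
    constructor
    · exact fun h => hx.2 ⟨hx.1, Or.inl h⟩
    · exact fun h => hx.2 ⟨hx.1, Or.inr h⟩
  by_cases hZe : Z = ∅
  · refine hS.2 A hA ?_
    rw [Set.disjoint_left]
    intro x hx hxS
    have : x ∈ Z := ⟨hx, Or.inl hxS⟩
    rw [hZe] at this
    exact this
  obtain ⟨s0, hs0⟩ := Set.nonempty_iff_ne_empty.2 hZe
  have hZf : Z.Finite := (hS.1.union hS'.1).subset Set.inter_subset_right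
  let RT : Set V → Set V := fun T => {x | x ∈ R ∧ ∃ s ∈ T, ∃ y ∈ cmp G R x, G.Adj y s}
  have h1 : ∀ s ∈ Z, QS Q G (insert s (RT {s})) := by
    intro s hs
    have hc : CSet G (insert s (RT {s})) := by
      refine cset_star (Set.mem_insert _ _) ?_
      rintro x (rfl | hx)
      · refine ⟨{x}, by simp, rfl, rfl, ⟨x, rfl⟩, ?_⟩
        rintro X ⟨z, rfl, hz⟩ - _ rfl
        exact hz
      · obtain ⟨hxR, _, rfl, y, hy, hys⟩ := hx
        refine ⟨insert _ (cmp G R x), ?_, Or.inr (self_mem_cmp hxR), Or.inl rfl,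
          cset_insert (cset_cmp hxR) hy hys⟩
        refine Set.insert_subset_insert ?_
        intro z hz
        exact ⟨hz.1, _, rfl, y, cmp_subset_cmp hz hy, hys⟩
    have hor : s ∉ S ∨ s ∉ S' := by
      by_contra hcon
      push Not at hcon
      exact hd hs.1 hcon
    rcases hor with h | h
    · refine hS.2 _ hc ?_
      rw [Set.disjoint_left]
      rintro x (rfl | hx)
      · exact h
      · exact (hRS x hx.1).1
    · refine hS'.2 _ hc ?_
      rw [Set.disjoint_left]
      rintro x (rfl | hx)
      · exact h
      · exact (hRS x hx.1).2
  have h2 : ∀ T : Set V, T.Finite → T ⊆ Z → QS Q G (RT T) := by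
    intro T hT
    induction T, hT using Set.Finite.induction_on with
    | empty =>
      intro _
      refine hQ.mono ?_ (h1 s0 hs0)
      rintro x ⟨-, s, hs, -⟩
      exact absurd hs (Set.notMem_empty s)
    | @insert s T _ _ ih =>
      intro hsub
      have hT := ih ((Set.subset_insert _ _).trans hsub)
      have hs := hQ.mono (Set.subset_insert _ _) (h1 s (hsub (Set.mem_insert _ _)))
      refine hQ.mono ?_ (hQ.union _ _ _ _ ?_ hs hT)
      · rintro x ⟨hx, t, ht | ht, y, hy, hyt⟩
        · exact Or.inl ⟨hx, t, ht, y, hy, hyt⟩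
        · exact Or.inr ⟨hx, t, ht, y, hy, hyt⟩
      · rintro x ⟨hx, t, ht, z, hz, hzt⟩ y ⟨hy, -⟩ hxy
        exact ⟨hy, t, ht, z, cmp_subset_cmp (cmp_closed (self_mem_cmp hx) hy hxy) hz, hzt⟩
  have h3 : QS Q G R := by
    refine hQ.mono ?_ (h2 Z hZf subset_rfl)
    intro x hx
    by_contra hcon
    have hno : ∀ s ∈ Z, ∀ y ∈ cmp G R x, ¬ G.Adj y s := fun s hs y hy hys =>
      hcon ⟨hx, s, hs, y, hy, hys⟩
    have := hA.2 (cmp G R x) ⟨x, hx.1, self_mem_cmp hx⟩ (by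
      intro a ha hax b hb hab
      by_cases hbZ : b ∈ Z
      · exact absurd hab (hno b hbZ a hax)
      · exact cmp_closed hax ⟨hb, hbZ⟩ hab)
    exact (this hs0.1).1.2 hs0
  have h4 : ∀ T : Set V, T.Finite → QS Q G (T ∪ R) := by
    intro T hT
    induction T, hT using Set.Finite.induction_on with
    | empty => simpa using h3
    | insert _ _ ih =>
      rw [Set.insert_union]
      exact hQ.add _ _ _ _ ih
  refine hQ.mono ?_ (h4 Z hZf)
  intro x hx
  by_cases hxZ : x ∈ Z
  · exact Or.inl hxZ
  · exact Or.inr ⟨hx, hxZ⟩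

def IsKer (Q : GClass.{u}) (G : SimpleGraph V) (K : Set V) : Prop :=
  Good Q G K ∧ ∀ S, Good Q G S → K ⊆ S

theorem exists_ker (hQ : Ideal Q) (h : (⟨V, G⟩ : Σ V : Type u, SimpleGraph V) ∈ next Q) :
    ∃ K, IsKer Q G K := by
  classical
  have hex : ∃ n, ∃ S, Good Q G S ∧ S.ncard = n := by
    obtain ⟨S, hS⟩ := h
    exact ⟨_, S, hS, rfl⟩
  obtain ⟨K, hK, hn⟩ := Nat.find_spec hex
  refine ⟨K, hK, fun S hS => ?_⟩
  have h1 := good_inter hQ hK hS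
  have h2 := Nat.find_min' hex ⟨_, h1, rfl⟩
  rw [← hn] at h2
  have := Set.eq_of_subset_of_ncard_le (Set.inter_subset_left (s := K) (t := S)) h2 hK.1
  rw [← this]
  exact Set.inter_subset_right

theorem ker_image (hQ : Ideal Q) {f : V → W} (hf : Function.Injective f)
    (hf' : ∀ a b, G.Adj a b → H.Adj (f a) (f b)) {g : W → V} (hg : Function.Injective g)
    (hg' : ∀ a b, H.Adj a b → G.Adj (g a) (g b)) {K : Set V} {L : Set W}
    (hK : IsKer Q G K) (hL : IsKer Q H L) : f '' K = L := by
  have h1 : f '' K ⊆ L := Set.image_subset_iff.2 (hK.2 _ (good_comap hQ hf hf' hL.1))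
  have h2 : g '' L ⊆ K := Set.image_subset_iff.2 (hL.2 _ (good_comap hQ hg hg' hK.1))
  refine Set.eq_of_subset_of_ncard_le h1 ?_ hL.1.1
  rw [Set.ncard_image_of_injective _ hf, ← Set.ncard_image_of_injective L hg]
  exact Set.ncard_le_ncard h2 hK.1.1

end Ideals

section Glue

variable {P : Type u} [PartialOrder P]

/-- delete the labelled vertices, remembering the adjacencies to them in the colour -/
def del {L : Type u} (A : CG P) (l : L → A.V) : CG (P × Set L) where
  V := {v : A.V // v ∉ Set.range l}
  G := A.G.induce {v : A.V | v ∉ Set.range l}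
  c := fun v => (A.c v.1, {k | A.G.Adj (l k) v.1})

/-- glue a labelled graph onto a core -/
def glue (M : CG P) (U : CG (P × Set M.V)) : CG P where
  V := M.V ⊕ U.V
  G :=
    { Adj := fun x y => match x, y with
        | Sum.inl a, Sum.inl b => M.G.Adj a b
        | Sum.inr a, Sum.inr b => U.G.Adj a b
        | Sum.inl a, Sum.inr b => a ∈ (U.c b).2
        | Sum.inr b, Sum.inl a => a ∈ (U.c b).2
      symm := by
        constructor
        rintro (a | a) (b | b) h
        · exact SimpleGraph.Adj.symm h
        · exact h
        · exact h
        · exact SimpleGraph.Adj.symm h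
      loopless := by
        constructor
        rintro (a | a) h
        · exact SimpleGraph.Adj.ne h rfl
        · exact SimpleGraph.Adj.ne h rfl }
  c := Sum.elim M.c (fun u => (U.c u).1)

def gl {M : CG P} {U : CG (P × Set M.V)} (a : M.V) : (glue M U).V := Sum.inl a
def gr {M : CG P} {U : CG (P × Set M.V)} (a : U.V) : (glue M U).V := Sum.inr a

section
variable {M : CG P} {U U' : CG (P × Set M.V)}

theorem gl_inj : Function.Injective (gl : M.V → (glue M U).V) := Sum.inl_injective
theorem gr_inj : Function.Injective (gr : U.V → (glue M U).V) := Sum.inr_injective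
theorem gl_ne_gr (a : M.V) (b : U.V) : (gl a : (glue M U).V) ≠ gr b := Sum.inl_ne_inr
theorem glue_cases (x : (glue M U).V) : (∃ a, x = gl a) ∨ ∃ a, x = gr a := by
  rcases x with a | a
  · exact Or.inl ⟨a, rfl⟩
  · exact Or.inr ⟨a, rfl⟩
theorem adj_ll (a b : M.V) : (glue M U).G.Adj (gl a) (gl b) ↔ M.G.Adj a b := Iff.rfl
theorem adj_rr (a b : U.V) : (glue M U).G.Adj (gr a) (gr b) ↔ U.G.Adj a b := Iff.rfl
theorem adj_lr (a : M.V) (b : U.V) : (glue M U).G.Adj (gl a) (gr b) ↔ a ∈ (U.c b).2 := Iff.rfl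
theorem adj_rl (a : M.V) (b : U.V) : (glue M U).G.Adj (gr b) (gl a) ↔ a ∈ (U.c b).2 := Iff.rfl
theorem c_gl (a : M.V) : (glue M U).c (gl a) = M.c a := rfl
theorem c_gr (a : U.V) : (glue M U).c (gr a) = (U.c a).1 := rfl

theorem glue_mono (h : Le U U') : ∃ f, IsEmb (glue M U) (glue M U') f ∧ ∀ a, f (gl a) = gl a := by
  obtain ⟨f, hf⟩ := h
  refine ⟨Sum.elim gl (fun x => gr (f x)), ⟨?_, ?_, ?_⟩, fun _ => rfl⟩
  · exact gl_inj.sumElim (gr_inj.comp hf.1) (fun a b => gl_ne_gr _ _)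
  · rintro (a | a) (b | b) h
    · exact h
    · exact (hf.2.2 b).2 h
    · exact (hf.2.2 a).2 h
    · exact hf.2.1 _ _ h
  · rintro (a | a)
    · exact le_rfl
    · exact (hf.2.2 a).1

theorem glue_iso (h : Iso U U') : ∃ e : (glue M U).V ≃ (glue M U').V,
    (∀ a b, (glue M U).G.Adj a b ↔ (glue M U').G.Adj (e a) (e b)) ∧
    (∀ a, (glue M U).c a = (glue M U').c (e a)) ∧ ∀ a, e (gl a) = gl a := by
  obtain ⟨e, h1, h2⟩ := h
  refine ⟨Equiv.sumCongr (Equiv.refl _) e, ?_, ?_, fun _ => rfl⟩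
  · rintro (a | a) (b | b)
    · exact Iff.rfl
    · change a ∈ (U.c b).2 ↔ a ∈ (U'.c (e b)).2
      rw [h2]
    · change b ∈ (U.c a).2 ↔ b ∈ (U'.c (e a)).2
      rw [h2]
    · exact h1 _ _
  · rintro (a | a)
    · rfl
    · change (U.c a).1 = (U'.c (e a)).1
      rw [h2]

theorem iso_of_glue (e : (glue M U).V ≃ (glue M U').V)
    (h1 : ∀ a b, (glue M U).G.Adj a b ↔ (glue M U').G.Adj (e a) (e b))
    (h2 : ∀ a, (glue M U).c a = (glue M U').c (e a)) (h3 : ∀ a, e (gl a) = gl a) : Iso U U' := by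
  have hr : ∀ x, ∃ y, e (gr x) = gr y := by
    intro x
    rcases glue_cases (e (gr x)) with ⟨a, ha⟩ | h
    · rw [← h3 a] at ha
      exact absurd (e.injective ha).symm (gl_ne_gr _ _)
    · exact h
  choose f hf using hr
  have hinj : Function.Injective f := by
    intro a b hab
    apply gr_inj (M := M)
    apply e.injective
    rw [hf, hf, hab]
  have hsurj : Function.Surjective f := by
    intro b
    rcases glue_cases (e.symm (gr b)) with ⟨a, ha⟩ | ⟨a, ha⟩
    · rw [Equiv.symm_apply_eq, h3] at ha
      exact absurd ha.symm (gl_ne_gr _ _)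
    · rw [Equiv.symm_apply_eq, hf] at ha
      exact ⟨a, (gr_inj ha).symm⟩
  refine ⟨Equiv.ofBijective f ⟨hinj, hsurj⟩, fun a b => ?_, fun a => ?_⟩
  · have := h1 (gr a) (gr b)
    rw [hf, hf, adj_rr, adj_rr] at this
    exact this
  · apply Prod.ext
    · have := h2 (gr a)
      rw [hf, c_gr, c_gr] at this
      exact this
    · ext k
      have := h1 (gl k) (gr a)
      rw [hf, h3, adj_lr, adj_lr] at this
      exact this

end

theorem glue_del (M A : CG P) (l : M.V → A.V) (hl : Function.Injective l)
    (h1 : ∀ a b, M.G.Adj a b ↔ A.G.Adj (l a) (l b)) (h2 : ∀ a, M.c a = A.c (l a)) :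
    ∃ e : (glue M (del A l)).V ≃ A.V,
    (∀ a b, (glue M (del A l)).G.Adj a b ↔ A.G.Adj (e a) (e b)) ∧
    (∀ a, (glue M (del A l)).c a = A.c (e a)) ∧ ∀ a, e (gl a) = l a := by
  let f : (glue M (del A l)).V → A.V := Sum.elim l (fun v => v.1)
  have hf : Function.Bijective f := by
    constructor
    · exact hl.sumElim Subtype.val_injective (fun a b h => b.2 ⟨a, h⟩)
    · intro v
      by_cases hv : v ∈ Set.range l
      · obtain ⟨a, rfl⟩ := hv
        exact ⟨gl a, rfl⟩
      · exact ⟨gr ⟨v, hv⟩, rfl⟩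
  refine ⟨Equiv.ofBijective f hf, ?_, ?_, fun _ => rfl⟩
  · rintro (a | a) (b | b)
    · exact h1 a b
    · exact Iff.rfl
    · exact A.G.adj_comm _ _
    · exact Iff.rfl
  · rintro (a | a)
    · exact h2 a
    · rfl

theorem del_mono {L : Type u} {A B : CG P} {l : L → A.V} {l' : L → B.V} {f : A.V → B.V}
    (hf : IsEmb A B f) (h : ∀ k, f (l k) = l' k) : Le (del A l) (del B l') := by
  refine ⟨fun v => ⟨f v.1, ?_⟩, ?_, ?_, ?_⟩
  · rintro ⟨k, hk⟩
    rw [← h] at hk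
    exact v.2 ⟨k, hf.1 hk⟩
  · intro a b hab
    exact Subtype.ext (hf.1 (congrArg Subtype.val hab))
  · intro a b hab
    exact hf.2.1 _ _ hab
  · intro a
    refine ⟨hf.2.2 a.1, ?_⟩
    intro k hk
    change B.G.Adj (l' k) (f a.1)
    rw [← h]
    exact hf.2.1 _ _ hk

theorem cmp_eq {V : Type u} {G : SimpleGraph V} {A : Set V} {x y : V} (hy : y ∈ cmp G A x) :
    cmp G A y = cmp G A x := by
  have hx : x ∈ A := by
    by_contra hx
    exact (hy.2 Aᶜ hx (fun _ h h' => absurd h h')) hy.1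
  exact Set.Subset.antisymm (cmp_subset_cmp (cmp_subset_cmp hy (self_mem_cmp hx)))
    (cmp_subset_cmp hy)

theorem exists_decomp (U : CG P) : ∃ (I : Type u) (C : I → CG P), (∀ i, Conn (C i)) ∧
    Iso U (sig C) := by
  let I := {S : Set U.V // ∃ b, S = cmp U.G Set.univ b}
  let C : I → CG P := fun S => ⟨S.1, U.G.induce S.1, fun x => U.c x.1⟩
  refine ⟨I, C, ?_, Iso.symm ?_⟩
  · rintro ⟨S, b, rfl⟩
    exact cset_iff_induce.1 (cset_cmp (Set.mem_univ b))
  · let f : (sig C).V → U.V := sdesc (fun i a => a.1)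
    have key : ∀ (i : I) (a : (C i).V), i.1 = cmp U.G Set.univ a.1 := by
      rintro ⟨S, b, rfl⟩ ⟨a, ha⟩
      exact (cmp_eq ha).symm
    have hf : Function.Bijective f := by
      constructor
      · intro x y hxy
        obtain ⟨i, a, rfl⟩ := exists_sin x
        obtain ⟨j, b, rfl⟩ := exists_sin y
        change a.1 = b.1 at hxy
        obtain rfl : i = j := by
          apply Subtype.ext
          rw [key i a, key j b, hxy]
        obtain rfl : a = b := Subtype.ext hxy
        rfl
      · intro v
        exact ⟨sin (⟨cmp U.G Set.univ v, v, rfl⟩ : I) ⟨v, self_mem_cmp trivial⟩, rfl⟩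
    refine ⟨Equiv.ofBijective f hf, ?_, ?_⟩
    · intro x y
      obtain ⟨i, a, rfl⟩ := exists_sin x
      obtain ⟨j, b, rfl⟩ := exists_sin y
      change _ ↔ U.G.Adj a.1 b.1
      constructor
      · intro h
        obtain rfl : i = j := sig_adj_fst h
        exact sig_adj.1 h
      · intro h
        obtain rfl : i = j := by
          apply Subtype.ext
          rw [key i a, key j b]
          exact (cmp_eq (cmp_closed (self_mem_cmp (Set.mem_univ _)) (Set.mem_univ _) h)).symm
        exact sig_adj.2 h
    · intro x
      rfl

theorem exists_label {L : Type u} [Nonempty L] {A : CG P} {l : L → A.V} (hA : Conn A)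
    {I : Type u} {C : I → CG (P × Set L)} (hC : ∀ i, Conn (C i)) (h : Iso (del A l) (sig C))
    (j : I) : ∃ a : (C j).V, ((C j).c a).2.Nonempty := by
  obtain ⟨e, h1, h2⟩ := h
  by_contra hcon
  push Not at hcon
  have hA' := connected_iff_cset.1 hA
  let Z : Set A.V := {v | ∃ h : v ∉ Set.range l, sidx (e ⟨v, h⟩) = j}
  have hlab : ∀ v : (del A l).V, sidx (e v) = j → ((del A l).c v).2 = ∅ := by
    intro v hv
    obtain ⟨a, ha⟩ := exists_sin_of hv
    rw [h2, ha]
    exact hcon a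
  obtain ⟨a⟩ := (hC j).nonempty
  have := hA'.2 Z ⟨(e.symm (sin j a)).1, trivial, (e.symm (sin j a)).2, by
      change sidx (e (e.symm (sin j a))) = j
      rw [e.apply_symm_apply]; rfl⟩ (by
    rintro v - ⟨hv, hvj⟩ w - hvw
    by_cases hw : w ∈ Set.range l
    · obtain ⟨k, rfl⟩ := hw
      have h3 : k ∈ ((del A l).c ⟨v, hv⟩).2 := hvw.symm
      rw [hlab _ hvj] at h3
      exact absurd h3 (Set.notMem_empty k)
    · refine ⟨hw, ?_⟩
      rw [← hvj]
      exact (sig_adj_fst ((h1 ⟨v, hv⟩ ⟨w, hw⟩).1 hvw)).symm)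
  obtain ⟨k⟩ := (inferInstance : Nonempty L)
  obtain ⟨hk, -⟩ := this (Set.mem_univ (l k))
  exact hk ⟨k, rfl⟩

theorem cset_union {V : Type u} {G : SimpleGraph V} {A B : Set V} (hA : CSet G A) (hB : CSet G B)
    {s : V} (hsA : s ∈ A) (hsB : s ∈ B) : CSet G (A ∪ B) := by
  refine cset_star (s := s) (Or.inl hsA) ?_
  rintro x (hx | hx)
  · exact ⟨A, Set.subset_union_left, hx, hsA, hA⟩
  · exact ⟨B, Set.subset_union_right, hx, hsB, hB⟩

theorem glue_conn {M A : CG P} [Nonempty M.V] (hA : Conn A) {I : Type u}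
    {C : I → CG (P × Set M.V)} (hC : ∀ i, Conn (C i))
    (hlab : ∀ i, ∃ a : (C i).V, ((C i).c a).2.Nonempty) {f : A.V → (glue M (sig C)).V}
    (hf : IsEmb A (glue M (sig C)) f) (hfr : ∀ k, ∃ v, f v = gl k) :
    Conn (glue M (sig C)) := by
  obtain ⟨k0⟩ := (inferInstance : Nonempty M.V)
  have hN : CSet (glue M (sig C)).G (f '' Set.univ) := (connected_iff_cset.1 hA).image hf.2.1
  have hk : ∀ k, gl k ∈ f '' Set.univ := by
    intro k
    obtain ⟨v, hv⟩ := hfr k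
    exact ⟨v, trivial, hv⟩
  refine connected_iff_cset.2 (cset_star (Set.mem_univ (gl k0)) ?_)
  intro x _
  rcases glue_cases x with ⟨k, rfl⟩ | ⟨y, rfl⟩
  · exact ⟨_, Set.subset_univ _, hk k, hk k0, hN⟩
  · obtain ⟨i, a, rfl⟩ := exists_sin y
    obtain ⟨b, k, hb⟩ := hlab i
    have hS : CSet (glue M (sig C)).G ((fun a => gr (sin i a)) '' (Set.univ : Set (C i).V)) :=
      (connected_iff_cset.1 (hC i)).image (fun a b hab => (adj_rr _ _).2 (sig_adj.2 hab))
    have hS' := cset_insert hS (y := gr (sin i b)) (s := gl k) ⟨b, trivial, rfl⟩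
      ((adj_rl _ _).2 hb)
    have := cset_union hN hS' (hk k) (Or.inl rfl)
    exact ⟨_, Set.subset_univ _, Or.inr (Or.inr ⟨a, trivial, rfl⟩), Or.inl (hk k0), this⟩

def PLe (A : CG P) (X : Set A.V) (B : CG P) (Y : Set B.V) : Prop := ∃ f, IsEmb A B f ∧ f '' X = Y

def PIso (A : CG P) (X : Set A.V) (B : CG P) (Y : Set B.V) : Prop :=
  ∃ e : A.V ≃ B.V, (∀ a b, A.G.Adj a b ↔ B.G.Adj (e a) (e b)) ∧ (∀ a, A.c a = B.c (e a)) ∧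
    e '' X = Y

theorem PIso.symm {A B : CG P} {X : Set A.V} {Y : Set B.V} (h : PIso A X B Y) :
    PIso B Y A X := by
  obtain ⟨e, h1, h2, rfl⟩ := h
  refine ⟨e.symm, fun a b => by simp [h1], fun a => by simp [h2], ?_⟩
  rw [← Set.image_comp]
  simp

theorem PIso.trans {A B C : CG P} {X : Set A.V} {Y : Set B.V} {Z : Set C.V} (h : PIso A X B Y)
    (h' : PIso B Y C Z) : PIso A X C Z := by
  obtain ⟨e, h1, h2, rfl⟩ := h
  obtain ⟨e', h1', h2', rfl⟩ := h'
  refine ⟨e.trans e', fun a b => by simp [h1, h1'], fun a => by simp [h2, h2'], ?_⟩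
  rw [← Set.image_comp]
  rfl

theorem PIso.refl (A : CG P) (X : Set A.V) : PIso A X A X :=
  ⟨Equiv.refl _, fun _ _ => Iff.rfl, fun _ => rfl, by simp⟩

theorem PLe.trans {A B C : CG P} {X : Set A.V} {Y : Set B.V} {Z : Set C.V} (h : PLe A X B Y)
    (h' : PLe B Y C Z) : PLe A X C Z := by
  obtain ⟨f, hf, rfl⟩ := h
  obtain ⟨g, hg, rfl⟩ := h'
  refine ⟨_, hg.comp hf, ?_⟩
  rw [← Set.image_comp]
  rfl

theorem PIso.le {A B : CG P} {X : Set A.V} {Y : Set B.V} (h : PIso A X B Y) : PLe A X B Y := by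
  obtain ⟨e, h1, h2, h3⟩ := h
  exact ⟨e, ⟨e.injective, fun a b => (h1 a b).1, fun a => (h2 a).le⟩, h3⟩

/-- choose infinitely many classes -/
theorem exists_reps {α : Type*} (r : α → α → Prop) (hr : Equivalence r) (F : ℕ → α)
    (hfin : ∀ k, {l | r (F k) (F l)}.Finite) :
    ∃ g : ℕ → ℕ, ∀ k l, k ≠ l → ¬ r (F (g k)) (F (g l)) := by
  let s : Setoid ℕ := ⟨fun k l => r (F k) (F l), fun _ => hr.refl _, fun h => hr.symm h,
    fun h h' => hr.trans h h'⟩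
  have hinf : Infinite (Quotient s) := by
    by_contra hcon
    have : Finite (Quotient s) := not_infinite_iff_finite.1 hcon
    have h2 : (⋃ q : Quotient s, {l | r (F q.out) (F l)}).Finite :=
      Set.finite_iUnion fun q => hfin _
    refine Set.infinite_univ (h2.subset ?_)
    intro l _
    refine Set.mem_iUnion.2 ⟨Quotient.mk s l, ?_⟩
    exact Quotient.mk_out (s := s) l
  refine ⟨fun k => (Infinite.natEmbedding (Quotient s) k).out, fun k l hkl h => ?_⟩
  exact hkl ((Infinite.natEmbedding (Quotient s)).injective (Quotient.out_equiv_out.1 h))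

theorem pairiso_finite {M : CG P} [Finite M.V] {F : ℕ → CG (P × Set M.V)}
    (hF : ∀ k l, k ≠ l → ¬ Iso (F k) (F l)) (k : ℕ) :
    {l | PIso (glue M (F k)) (Set.range gl) (glue M (F l)) (Set.range gl)}.Finite := by
  by_contra hinf
  have : ∀ l : {l | PIso (glue M (F k)) (Set.range gl) (glue M (F l)) (Set.range gl)},
      ∃ (e : (glue M (F k)).V ≃ (glue M (F l)).V) (p : M.V → M.V),
      (∀ a b, (glue M (F k)).G.Adj a b ↔ (glue M (F l)).G.Adj (e a) (e b)) ∧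
      (∀ a, (glue M (F k)).c a = (glue M (F l)).c (e a)) ∧ ∀ a, e (gl a) = gl (p a) := by
    rintro ⟨l, e, h1, h2, h3⟩
    have : ∀ a, ∃ b, e (gl a) = gl b := by
      intro a
      have : e (gl a) ∈ Set.range gl := h3 ▸ ⟨gl a, ⟨a, rfl⟩, rfl⟩
      obtain ⟨b, hb⟩ := this
      exact ⟨b, hb.symm⟩
    choose p hp using this
    exact ⟨e, p, h1, h2, hp⟩
  choose e p h1 h2 h3 using this
  have hinf' := Set.infinite_coe_iff.2 hinf
  obtain ⟨l, l', hne, hp⟩ := Finite.exists_ne_map_eq_of_infinite p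
  apply hF l l' (fun h => hne (Subtype.ext h))
  refine iso_of_glue ((e l).symm.trans (e l')) (fun a b => ?_) (fun a => ?_) (fun a => ?_)
  · rw [Equiv.trans_apply, Equiv.trans_apply, ← h1, h1 l]
    simp
  · rw [Equiv.trans_apply, ← h2, h2 l]
    simp
  · have hpb : Function.Surjective (p l) := by
      apply Finite.surjective_of_injective
      intro a b hab
      apply gl_inj (U := F k)
      apply (e l).injective
      rw [h3, h3, hab]
    obtain ⟨b, rfl⟩ := hpb a
    rw [← h3, Equiv.trans_apply, Equiv.symm_apply_apply, h3, hp]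

end Glue

section LemmaK

variable {P : Type u} [PartialOrder P]

theorem IsEmb.iterate {A : CG P} {f : A.V → A.V} (hf : IsEmb A A f) (n : ℕ) :
    IsEmb A A (f^[n]) := by
  induction n with
  | zero => exact IsEmb.refl A
  | succ n ih =>
    rw [Function.iterate_succ]
    exact ih.comp hf

theorem exists_periodic {α : Type*} {X : Set α} (hX : X.Finite) {s : α → α}
    (hs : Function.Injective s) (hm : Set.MapsTo s X X) : ∃ n, ∀ x ∈ X, s^[n + 1] x = x := by
  have := hX.to_subtype
  have hinj : Function.Injective (hm.restrict s X X) := by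
    intro a b hab
    exact Subtype.ext (hs (congrArg Subtype.val hab))
  let e : Equiv.Perm X := Equiv.ofBijective _ (Finite.injective_iff_bijective.1 hinj)
  have hpos : 0 < orderOf e := orderOf_pos e
  refine ⟨orderOf e - 1, fun x hx => ?_⟩
  rw [Nat.sub_add_cancel hpos]
  have h1 : (e ^ orderOf e) ⟨x, hx⟩ = ⟨x, hx⟩ := by rw [pow_orderOf_eq_one]; rfl
  rw [← Equiv.Perm.iterate_eq_pow] at h1
  have h2 : (⇑e)^[orderOf e] = (hm.restrict s X X)^[orderOf e] := rfl
  rw [h2, Set.MapsTo.iterate_restrict] at h1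
  exact congrArg Subtype.val h1

theorem exists_retract {A B : CG P} {X : Set A.V} {Y : Set B.V} (hX : X.Finite)
    (h : PLe A X B Y) (h' : PLe B Y A X) :
    ∃ f g, IsEmb A B f ∧ IsEmb B A g ∧ f '' X = Y ∧ ∀ x ∈ X, g (f x) = x := by
  obtain ⟨f, hf, hfX⟩ := h
  obtain ⟨g, hg, hgY⟩ := h'
  have hs := hg.comp hf
  obtain ⟨n, hn⟩ := exists_periodic hX hs.1 (by
    intro x hx
    rw [← hgY, ← hfX]
    exact ⟨_, ⟨x, hx, rfl⟩, rfl⟩)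
  refine ⟨f, _, hf, (hs.iterate n).comp hg, hfX, fun x hx => ?_⟩
  have := hn x hx
  rw [Function.iterate_succ_apply] at this
  exact this

theorem lemmaK {A B : CG P} {X : Set A.V} {Y : Set B.V} (hX : X.Finite)
    (hrA : A.G.IsRayless) (hrB : B.G.IsRayless) (h : PLe A X B Y) (h' : PLe B Y A X)
    (hn : ¬ PIso A X B Y)
    (hAlt : ∀ C : CG (P × Set X), Conn C → ∀ f : C.V → A.V, Function.Injective f →
      (∀ a b, C.G.Adj a b → A.G.Adj (f a) (f b)) → (∀ x, f x ∉ X) → Alt C) :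
    ∃ T : ℕ → Σ D : CG P, Set D.V, (∀ k, (T k).2.Finite) ∧
      (∀ k, PLe A X (T k).1 (T k).2 ∧ PLe (T k).1 (T k).2 A X) ∧
      (∀ k l, k ≠ l → ¬ PIso (T k).1 (T k).2 (T l).1 (T l).2) ∧
      (Conn A → Conn B → X.Nonempty → ∀ k, Conn (T k).1) := by
  have hXfin := hX.to_subtype
  obtain ⟨f, g, hf, hg, hfX, hgf⟩ := exists_retract hX h h'
  let M : CG P := ⟨X, A.G.induce X, fun x => A.c x.1⟩
  have hMfin : Finite M.V := hXfin
  let lA : M.V → A.V := fun x => x.1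
  let lB : M.V → B.V := fun x => f x.1
  have hgl : ∀ k : M.V, g (lB k) = lA k := fun k => hgf k.1 k.2
  have hlA : Function.Injective lA := Subtype.val_injective
  have hlB : Function.Injective lB := hf.1.comp hlA
  have hrgA : Set.range lA = X := Subtype.range_val
  have hrgB : Set.range lB = Y := by
    rw [← hfX]
    change Set.range (f ∘ Subtype.val) = _
    rw [Set.range_comp, Subtype.range_val]
  obtain ⟨eA, hA1, hA2, hA3⟩ := glue_del M A lA hlA (fun _ _ => Iff.rfl) (fun _ => rfl)
  obtain ⟨eB, hB1, hB2, hB3⟩ := glue_del M B lB hlB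
    (fun a b => ⟨fun hab => hf.2.1 _ _ hab, fun hab => by
      have := hg.2.1 _ _ hab
      rw [hgl, hgl] at this
      exact this⟩)
    (fun a => le_antisymm (hf.2.2 a.1) (by
      have := hg.2.2 (lB a)
      rw [hgl] at this
      exact this))
  have hle1 : Le (del A lA) (del B lB) := del_mono hf (fun _ => rfl)
  have hle2 : Le (del B lB) (del A lA) := del_mono hg hgl
  have hPA : PIso (glue M (del A lA)) (Set.range gl) A X := by
    refine ⟨eA, hA1, hA2, ?_⟩
    rw [← hrgA, ← Set.range_comp]
    exact congrArg Set.range (funext hA3)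
  have hPB : PIso (glue M (del B lB)) (Set.range gl) B Y := by
    refine ⟨eB, hB1, hB2, ?_⟩
    rw [← hrgB, ← Set.range_comp]
    exact congrArg Set.range (funext hB3)
  have hni : ¬ Iso (del A lA) (del B lB) := by
    intro hi
    obtain ⟨e, h1, h2, h3⟩ := glue_iso (M := M) hi
    refine hn (hPA.symm.trans (PIso.trans ⟨e, h1, h2, ?_⟩ hPB))
    rw [← Set.range_comp]
    exact congrArg Set.range (funext h3)
  obtain ⟨I, C, hC, hIC⟩ := exists_decomp (del A lA)
  obtain ⟨J, D, hD, hJD⟩ := exists_decomp (del B lB)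
  have hCA : ∀ i, ∃ q : (C i).V → A.V, Function.Injective q ∧
      (∀ a b, (C i).G.Adj a b → A.G.Adj (q a) (q b)) ∧ ∀ x, q x ∉ X := by
    intro i
    obtain ⟨q, hq⟩ := hIC.symm.le
    have hq' := hq.comp (isEmb_incl i)
    refine ⟨fun a => (q (sin i a)).1, fun a b hab => hq'.1 (Subtype.ext hab),
      fun a b hab => hq'.2.1 _ _ hab, fun x => ?_⟩
    exact fun hx => (q (sin i x)).2 ⟨⟨_, hx⟩, rfl⟩
  have hDB : ∀ i, ∃ q : (D i).V → B.V, Function.Injective q ∧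
      (∀ a b, (D i).G.Adj a b → B.G.Adj (q a) (q b)) := by
    intro i
    obtain ⟨q, hq⟩ := hJD.symm.le
    have hq' := hq.comp (isEmb_incl i)
    exact ⟨fun a => (q (sin i a)).1, fun a b hab => hq'.1 (Subtype.ext hab),
      fun a b hab => hq'.2.1 _ _ hab⟩
  obtain ⟨F, hF1, hF2, hF3, hF4⟩ := union_lemma hC hD
    (hIC.symm.eqv.trans (Eqv.trans ⟨hle1, hle2⟩ hJD.eqv))
    (fun hi => hni (hIC.trans (hi.trans hJD.symm)))
    (fun i => by
      obtain ⟨q, h1, h2, h3⟩ := hCA i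
      exact hAlt _ (hC i) q h1 h2 h3)
    (fun i => by
      obtain ⟨q, h1, h2, h3⟩ := hCA i
      exact not_plus_self_le (hC i) (IsRayless_of_hom h1 h2 hrA))
    (fun i => by
      obtain ⟨q, h1, h2⟩ := hDB i
      exact not_plus_self_le (hD i) (IsRayless_of_hom h1 h2 hrB))
  obtain ⟨r, hr⟩ := exists_reps
    (fun a b : CG (P × Set M.V) => PIso (glue M a) (Set.range gl) (glue M b) (Set.range gl))
    ⟨fun _ => PIso.refl _ _, fun h => h.symm, fun h h' => h.trans h'⟩
    (fun k => sig (F k).2) (pairiso_finite hF3)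
  have hle : ∀ U U' : CG (P × Set M.V), Le U U' →
      PLe (glue M U) (Set.range gl) (glue M U') (Set.range gl) := by
    intro U U' hU
    obtain ⟨q, hq, hq'⟩ := glue_mono (M := M) hU
    refine ⟨q, hq, ?_⟩
    rw [← Set.range_comp]
    exact congrArg Set.range (funext hq')
  have hAT : ∀ k, PLe A X (glue M (sig (F k).2)) (Set.range gl) := fun k =>
    hPA.symm.le.trans (hle _ _ (hIC.le.trans (hF2 k).1))
  refine ⟨fun k => ⟨glue M (sig (F (r k)).2), Set.range gl⟩, fun k => Set.finite_range _,
    fun k => ⟨hAT _, (hle _ _ ((hF2 _).2.trans hIC.symm.le)).trans hPA.le⟩, hr, ?_⟩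
  intro cA cB hXne k
  have : Nonempty M.V := hXne.to_subtype
  obtain ⟨q, hq, hqX⟩ := hAT (r k)
  refine glue_conn cA (hF1 _) ?_ hq ?_
  · intro i
    have hup : ∀ U U' : CG (P × Set M.V), Le U U' → (∃ a, (U.c a).2.Nonempty) →
        ∃ a, (U'.c a).2.Nonempty := by
      rintro U U' ⟨t, ht⟩ ⟨a, ha⟩
      exact ⟨t a, ha.mono (ht.2.2 a).2⟩
    rcases hF4 (r k) i with ⟨j, hj⟩ | ⟨j, hj⟩
    · exact hup _ _ hj (exists_label cA hC hIC j)
    · exact hup _ _ hj (exists_label cB hD hJD j)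
  · intro m
    have : gl m ∈ q '' X := by rw [hqX]; exact ⟨m, rfl⟩
    obtain ⟨v, -, hv⟩ := this
    exact ⟨v, hv⟩

end LemmaK

section Induction

def AltG (g : Σ V : Type u, SimpleGraph V) : Prop :=
  ∀ (P : Type u) [PartialOrder P] (c : g.1 → P), g.2.Connected → g.2.IsRayless →
    Alt (⟨g.1, g.2, c⟩ : CG P)

theorem alt_next {Q : GClass.{u}} (hQ : Ideal Q) (hA : ∀ g ∈ Q, AltG g) :
    ∀ g ∈ next Q, AltG g := by
  rintro ⟨V, G⟩ hg P _ c hconn hray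
  by_cases hgQ : (⟨V, G⟩ : Σ V : Type u, SimpleGraph V) ∈ Q
  · exact hA _ hgQ P c hconn hray
  intro D hD hE hn
  change G.Connected at hconn
  change G.IsRayless at hray
  obtain ⟨⟨f, hf⟩, ⟨g, hg'⟩⟩ := id hE
  obtain ⟨K, hK⟩ := exists_ker hQ hg
  obtain ⟨K', hK'⟩ := exists_ker hQ
    (hQ.next.hom _ _ D.G G g hg'.1 hg'.2.1 hg)
  have hfK : f '' K = K' := ker_image hQ hf.1 hf.2.1 hg'.1 hg'.2.1 hK hK'
  have hgK : g '' K' = K := ker_image hQ hg'.1 hg'.2.1 hf.1 hf.2.1 hK' hK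
  have hKne : K.Nonempty := by
    by_contra hKe
    rw [Set.not_nonempty_iff_eq_empty] at hKe
    apply hgQ
    rw [← hQ.univ]
    apply hK.1.2 _ (connected_iff_cset.1 hconn)
    rw [hKe]
    exact Set.disjoint_empty _
  obtain ⟨T, hT1, hT2, hT3, hT4⟩ := lemmaK (A := ⟨V, G, c⟩) (B := D) (X := K) (Y := K') hK.1.1 hray
    (IsRayless_of_hom hg'.1 hg'.2.1 hray) ⟨f, hf, hfK⟩ ⟨g, hg', hgK⟩
    (by
      rintro ⟨e, h1, h2, -⟩
      exact hn ⟨e, h1, h2⟩)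
    (by
      intro C hC q hq1 hq2 hq3
      refine hA ⟨C.V, C.G⟩ ?_ _ C.c hC (IsRayless_of_hom hq1 hq2 hray)
      rw [← hQ.univ]
      refine hQ.map (f := q) hq1.injOn (fun a _ b _ => hq2 a b)
        (fun a ha => Set.mem_image_of_mem q ha)
        (hK.1.2 (q '' Set.univ) ((connected_iff_cset.1 hC).image hq2) ?_)
      rw [Set.disjoint_left]
      rintro _ ⟨a, -, rfl⟩
      exact hq3 a)
  have hker : ∀ k, IsKer Q (T k).1.G (T k).2 := by
    intro k
    obtain ⟨⟨p, hp, hpX⟩, ⟨q, hq, -⟩⟩ := hT2 k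
    obtain ⟨L, hL⟩ := exists_ker hQ (hQ.next.hom _ _ (T k).1.G G q hq.1 hq.2.1 hg)
    have : p '' K = L := ker_image hQ hp.1 hp.2.1 hq.1 hq.2.1 hK hL
    rw [← hpX, this]
    exact hL
  refine ⟨fun k => (T k).1, fun k => hT4 hconn hD hKne k, fun k => ?_, fun k l hkl hi => ?_⟩
  · obtain ⟨⟨p, hp, -⟩, ⟨q, hq, -⟩⟩ := hT2 k
    exact ⟨⟨p, hp⟩, ⟨q, hq⟩⟩
  · obtain ⟨q, hq⟩ := hi.symm.le
    obtain ⟨e, h1, h2⟩ := hi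
    exact hT3 k l hkl ⟨e, h1, h2, ker_image hQ e.injective (fun a b => (h1 a b).1) hq.1 hq.2.1
      (hker k) (hker l)⟩

theorem exists_max : ∃ Q : GClass.{u}, Ideal Q ∧ (∀ g ∈ Q, AltG g) ∧ next Q ⊆ Q := by
  obtain ⟨Q, hQ⟩ := zorn_subset {Q : GClass.{u} | Ideal Q ∧ ∀ g ∈ Q, AltG g} (by
    intro c hc hch
    refine ⟨⋃₀ c, ⟨⟨?_, ?_, ?_⟩, ?_⟩, fun s hs => Set.subset_sUnion_of_mem hs⟩
    · rintro V W G H f hf hadj ⟨Q, hQ, h⟩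
      exact ⟨Q, hQ, (hc hQ).1.hom V W G H f hf hadj h⟩
    · rintro V G A B hAB ⟨Q, hQ, h⟩ ⟨Q', hQ', h'⟩
      rcases hch.total hQ hQ' with hs | hs
      · exact ⟨Q', hQ', (hc hQ').1.union V G A B hAB (hs h) h'⟩
      · exact ⟨Q, hQ, (hc hQ).1.union V G A B hAB h (hs h')⟩
    · rintro V G A s ⟨Q, hQ, h⟩
      exact ⟨Q, hQ, (hc hQ).1.add V G A s h⟩
    · rintro g ⟨Q, hQ, h⟩
      exact (hc hQ).2 g h)
  refine ⟨Q, hQ.1.1, hQ.1.2, ?_⟩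
  exact hQ.2 ⟨hQ.1.1.next, alt_next hQ.1.1 hQ.1.2⟩ hQ.1.1.subset_next

theorem all_alt {P : Type u} [PartialOrder P] (C : CG P) (hC : Conn C) (hray : C.G.IsRayless) :
    Alt C := by
  obtain ⟨Q, hQ, hA, hmax⟩ := exists_max.{u}
  by_cases hCQ : (⟨C.V, C.G⟩ : Σ V : Type u, SimpleGraph V) ∈ Q
  · exact hA _ hCQ P C.c hC hray
  refine absurd hray (exists_ray (fun A => ¬ QS Q C.G A) (fun A B hAB h h' => h (hQ.mono hAB h'))
    ⟨Set.univ, fun h => hCQ (hQ.univ.1 h), connected_iff_cset.1 hC⟩ ?_)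
  intro A hAbig hAc v hv
  by_contra hcon
  apply hAbig
  apply hmax
  change QS (next Q) C.G A
  rw [qs_next hQ]
  refine ⟨{v}, Set.finite_singleton v, fun B hBA hB hd => ?_⟩
  by_contra hBQ
  exact hcon ⟨B, fun x hx => ⟨hBA hx, Set.disjoint_left.1 hd hx⟩, hBQ, hB⟩

end Induction

end RT

/-- If the pairs `(G, X)` and `(H, Y)` (with `G`, `H` rayless and `X`, `Y` finite)
are weak twins, then `(G, X)` has infinitely many pairwise non-isomorphic weak
twins. -/
theorem weakTwinPairs_infinite {V W : Type u} (G : SimpleGraph V) (H : SimpleGraph W)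
    (X : Set V) (Y : Set W) (hX : X.Finite) (hY : Y.Finite)
    (hG : G.IsRayless) (hH : H.IsRayless)
    (htwin : WeakTwinPairs G X H Y) :
    ∃ F : ℕ → Σ W' : Type u, SimpleGraph W' × Set W',
      (∀ i, (F i).2.2.Finite) ∧
      (∀ i j, i ≠ j → ¬ PairIso (F i).2.1 (F i).2.2 (F j).2.1 (F j).2.2) ∧
      ∀ i, WeakTwinPairs G X (F i).2.1 (F i).2.2 := by
  obtain ⟨hn, ⟨φ, hφ, hφX⟩, ⟨ψ, hψ, hψY⟩⟩ := htwin
  let A : RT.CG PUnit.{u+1} := ⟨V, G, fun _ => PUnit.unit⟩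
  let B : RT.CG PUnit.{u+1} := ⟨W, H, fun _ => PUnit.unit⟩
  have hiso : ∀ (D E : RT.CG PUnit.{u+1}) (S : Set D.V) (R : Set E.V),
      PairIso D.G S E.G R ↔ RT.PIso D S E R := by
    intro D E S R
    constructor
    · rintro ⟨γ, hγ⟩
      exact ⟨γ.toEquiv, fun a b => γ.map_adj_iff.symm, fun _ => rfl, hγ⟩
    · rintro ⟨e, h1, -, h3⟩
      exact ⟨⟨e, fun {a b} => (h1 a b).symm⟩, h3⟩
  obtain ⟨T, hT1, hT2, hT3, -⟩ := RT.lemmaK (A := A) (B := B) (X := X) (Y := Y) hX hG hH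
    ⟨φ, ⟨hφ, fun a b h => φ.map_adj h, fun _ => le_rfl⟩, hφX⟩
    ⟨ψ, ⟨hψ, fun a b h => ψ.map_adj h, fun _ => le_rfl⟩, hψY⟩
    (fun h => hn ((hiso A B X Y).2 h))
    (fun C hC f hf hf' _ => RT.all_alt C hC (RT.IsRayless_of_hom hf hf' hG))
  have hex : ∃ m : ℕ, ∀ k, ¬ RT.PIso A X (T (k + m)).1 (T (k + m)).2 := by
    by_cases h : ∃ k, RT.PIso A X (T k).1 (T k).2
    · obtain ⟨k0, hk0⟩ := h
      refine ⟨k0 + 1, fun k hk => ?_⟩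
      exact hT3 k0 (k + (k0 + 1)) (by omega) (hk0.symm.trans hk)
    · exact ⟨0, fun k hk => h ⟨_, hk⟩⟩
  obtain ⟨m, hm⟩ := hex
  refine ⟨fun k => ⟨(T (k + m)).1.V, (T (k + m)).1.G, (T (k + m)).2⟩, fun k => hT1 _,
    fun i j hij h => ?_, fun i => ⟨fun h => ?_, ?_, ?_⟩⟩
  · exact hT3 (i + m) (j + m) (by omega) ((hiso _ _ _ _).1 h)
  · exact hm i ((hiso A _ _ _).1 h)
  · obtain ⟨⟨p, hp, hpX⟩, -⟩ := hT2 (i + m)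
    exact ⟨⟨p, fun {a b} h => hp.2.1 a b h⟩, hp.1, hpX⟩
  · obtain ⟨-, ⟨p, hp, hpX⟩⟩ := hT2 (i + m)
    exact ⟨⟨p, fun {a b} h => hp.2.1 a b h⟩, hp.1, hpX⟩
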